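/- arXiv:1704.03758 — 10 statements merged into one kernel-verified Lean document; each statement's English description precedes it below -/
import Mathlib

section
/- Let a₁,…,a_k and b₁,…,b_ℓ be fixed positive integers with A := a₁+⋯+a_k > B := b₁+⋯+b_ℓ. Then there exists λ > 0 (one may take λ = (1 − B/A)/(2A)) such that, for all sufficiently large m, the group ℤ/mℤ contains an L-free subset S of size at least λm with 0 ∉ S. -/
/-- If `B * d < A * c`, `A * d < m` and `B < A`, where `A = ∑ a` and `B = ∑ b`, then no choice of
elements of `[c, d]` solves `∑ a x = ∑ b y` modulo `m`. -/
theorem sum_mul_not_modEq_of_mem_Icc {ι κ : Type*} [Fintype ι] [Fintype κ] (a : ι → ℕ) (b : κ → ℕ)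
    {c d m : ℕ} (hAB : ∑ j, b j < ∑ i, a i) (hc : (∑ j, b j) * d < (∑ i, a i) * c)
    (hd : (∑ i, a i) * d < m) (x : ι → ℕ) (y : κ → ℕ) (hx : ∀ i, x i ∈ Finset.Icc c d)
    (hy : ∀ j, y j ∈ Finset.Icc c d) :
    ¬ ∑ i, a i * x i ≡ ∑ j, b j * y j [MOD m] := by
  intro h
  have hx_le : ∑ i, a i * x i ≤ (∑ i, a i) * d := by
    rw [Finset.sum_mul]
    exact Finset.sum_le_sum fun i _ => Nat.mul_le_mul_left _ (Finset.mem_Icc.1 (hx i)).2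
  have le_hx : (∑ i, a i) * c ≤ ∑ i, a i * x i := by
    rw [Finset.sum_mul]
    exact Finset.sum_le_sum fun i _ => Nat.mul_le_mul_left _ (Finset.mem_Icc.1 (hx i)).1
  have hy_le : ∑ j, b j * y j ≤ (∑ j, b j) * d := by
    rw [Finset.sum_mul]
    exact Finset.sum_le_sum fun j _ => Nat.mul_le_mul_left _ (Finset.mem_Icc.1 (hy j)).2
  have hBd : (∑ j, b j) * d ≤ (∑ i, a i) * d := Nat.mul_le_mul_right _ hAB.le
  have := h.eq_of_lt_of_lt (by omega) (by omega)
  omega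

/-- Lower bound for the number of integers in `(B * d / A, d]`, where `d = (m - 1) / A`. -/
theorem mul_le_card_Icc_div {A B m : ℕ} (hAB : B < A) (hm : 2 * A ≤ m) :
    (1 - (B : ℝ) / A) / (2 * A) * m ≤
      ((Finset.Icc (B * ((m - 1) / A) / A + 1) ((m - 1) / A)).card : ℝ) := by
  have hA : 0 < A := by omega
  have hA' : (0 : ℝ) < A := by exact_mod_cast hA
  have hBA : (B : ℝ) / A ≤ 1 := (div_le_one hA').2 (by exact_mod_cast hAB.le)
  set d := (m - 1) / A with hd
  have hcd : B * d / A ≤ d := Nat.div_le_of_le_mul (Nat.mul_le_mul_right _ hAB.le)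
  have hmd : m ≤ A * (d + 1) := by
    have := Nat.lt_mul_div_succ (m - 1) hA
    rw [← hd] at this
    omega
  have hmd' : (m : ℝ) ≤ A * (d + 1) := by exact_mod_cast hmd
  have hm' : (2 : ℝ) * A ≤ m := by exact_mod_cast hm
  have hmd2 : (m : ℝ) / (2 * A) ≤ d := by
    rw [div_le_iff₀ (by positivity)]
    nlinarith
  have hq : ((B * d / A : ℕ) : ℝ) ≤ B / A * d := by
    refine Nat.cast_div_le.trans_eq ?_
    push_cast
    ring
  rw [Nat.card_Icc, Nat.add_sub_add_right, Nat.cast_sub hcd]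
  calc (1 - (B : ℝ) / A) / (2 * A) * m = (1 - (B : ℝ) / A) * (m / (2 * A)) := by ring
    _ ≤ (1 - (B : ℝ) / A) * d := mul_le_mul_of_nonneg_left hmd2 (by linarith)
    _ ≤ d - (B * d / A : ℕ) := by linarith


/-- If `A := ∑ a > B := ∑ b` then with `λ = (1 − B/A)/(2A) > 0`, for all
sufficiently large `m` the group `ℤ/mℤ` contains an L-free subset `S` of size at least `λm`
with `0 ∉ S`. -/
theorem stmt_2 (k l : ℕ) (a : Fin k → ℕ) (b : Fin l → ℕ)
    (ha : ∀ i, 0 < a i) (hb : ∀ j, 0 < b j)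
    (hAB : ∑ j, b j < ∑ i, a i) :
    ∃ lam : ℝ, 0 < lam ∧
      lam = (1 - (∑ j, b j : ℝ) / (∑ i, a i : ℝ)) / (2 * (∑ i, a i : ℝ)) ∧
      ∃ N : ℕ, ∀ m : ℕ, N ≤ m →
        ∃ S : Finset (ZMod m), (0 : ZMod m) ∉ S ∧ lam * (m : ℝ) ≤ (S.card : ℝ) ∧
          ¬ ∃ (x : Fin k → ZMod m) (y : Fin l → ZMod m),
            (∀ i, x i ∈ S) ∧ (∀ j, y j ∈ S) ∧
            ∑ i, (a i : ZMod m) * x i = ∑ j, (b j : ZMod m) * y j := by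
  set A := ∑ i, a i with hA_def
  set B := ∑ j, b j with hB_def
  have hA : 0 < A := by omega
  have hA' : (0 : ℝ) < A := by exact_mod_cast hA
  have hBA : (B : ℝ) / A < 1 := (div_lt_one hA').2 (by exact_mod_cast hAB)
  rw [← Nat.cast_sum, ← Nat.cast_sum, ← hA_def, ← hB_def]
  refine ⟨_, div_pos (by linarith) (by positivity), rfl, 2 * A, fun m hm => ?_⟩
  set d := (m - 1) / A with hd
  set c := B * d / A + 1
  have hAd : A * d < m := by
    have := Nat.mul_div_le (m - 1) A
    rw [← hd] at this
    omega
  have hc1 : 1 ≤ c := Nat.le_add_left 1 _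
  have hdm : d < m := (Nat.le_mul_of_pos_left d hA).trans_lt hAd
  have hBd : B * d < A * c := Nat.lt_mul_div_succ _ hA
  refine ⟨(Finset.Icc c d).image (Nat.cast : ℕ → ZMod m), ?_, ?_, ?_⟩
  · rw [Finset.mem_image]
    rintro ⟨n, hn, h⟩
    rw [Finset.mem_Icc] at hn
    exact absurd (Nat.le_of_dvd (hc1.trans hn.1) ((ZMod.natCast_eq_zero_iff n m).1 h))
      (hn.2.trans_lt hdm).not_ge
  · rw [Finset.card_image_of_injOn]
    · exact mul_le_card_Icc_div hAB hm
    · intro n hn n' hn' h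
      rw [Finset.mem_coe, Finset.mem_Icc] at hn hn'
      exact ((ZMod.natCast_eq_natCast_iff n n' m).1 h).eq_of_lt_of_lt (by omega) (by omega)
  · rintro ⟨x, y, hx, hy, h⟩
    simp only [Finset.mem_image] at hx hy
    choose x' hx' hxx using hx
    choose y' hy' hyy using hy
    refine sum_mul_not_modEq_of_mem_Icc a b hAB hBd hAd x' y' hx' hy' ?_
    rw [← ZMod.natCast_eq_natCast_iff]
    push_cast
    simpa only [hxx, hyy] using h
end

section
/- Let a₁,…,a_k and b₁,…,b_ℓ be fixed positive integers, let Z be a finite set of nonzero integers, let p be a prime with p > 2·max{|z| : z ∈ Z}, and let S be an L-free subset of ℤ/pℤ with 0 ∉ S. Then there exists x ∈ {1,…,p−1} and a subset Z' ⊆ Z with |Z'| ≥ |S|·|Z|/(p−1) such that the residue of x·z modulo p lies in S for every z ∈ Z'; moreover any such Z' is an L-free set of integers. -/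
/-- If `z` is nonzero modulo a prime `p`, every subset `S` of `ZMod p` avoiding `0` is hit at least
`S.card` times by the dilates `x * z` with `1 ≤ x ≤ p - 1`. -/
theorem card_le_card_filter_dilate_mem {p : ℕ} [Fact p.Prime] {S : Finset (ZMod p)}
    (hS0 : (0 : ZMod p) ∉ S) {z : ZMod p} (hz : z ≠ 0) :
    S.card ≤ ((Finset.Icc 1 (p - 1)).filter fun x : ℕ => (x : ZMod p) * z ∈ S).card := by
  refine Finset.card_le_card_of_injOn (fun s => (s * z⁻¹).val) ?_ ?_
  · intro s hs
    have hs0 : s ≠ 0 := fun h => hS0 (h ▸ hs)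
    have hpos : (s * z⁻¹).val ≠ 0 := by
      rw [Ne, ZMod.val_eq_zero]
      exact mul_ne_zero hs0 (inv_ne_zero hz)
    have hlt := ZMod.val_lt (s * z⁻¹)
    have hmem : (((s * z⁻¹).val : ℕ) : ZMod p) * z ∈ S := by
      rw [ZMod.natCast_zmod_val, inv_mul_cancel_right₀ hz]
      exact hs
    rw [Finset.mem_coe, Finset.mem_filter, Finset.mem_Icc]
    exact ⟨⟨Nat.one_le_iff_ne_zero.2 hpos, Nat.le_sub_one_of_lt hlt⟩, hmem⟩
  · intro s _ t _ hst
    exact mul_right_cancel₀ (inv_ne_zero hz) (ZMod.val_injective p hst)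

/-- Given a finite set `Z` of nonzero integers, a prime `p > 2·max|z|`, and an
L-free subset `S` of `ℤ/pℤ` with `0 ∉ S`, there are `x ∈ {1,…,p−1}` and `Z' ⊆ Z` with
`|Z'| ≥ |S|·|Z|/(p−1)` such that `x·z mod p ∈ S` for all `z ∈ Z'`; moreover any such `Z'`
is an L-free set of integers. -/
theorem stmt_3 (k l : ℕ) (a : Fin k → ℕ) (b : Fin l → ℕ)
    (ha : ∀ i, 0 < a i) (hb : ∀ j, 0 < b j)
    (Z : Finset ℤ) (hZ0 : ∀ z ∈ Z, z ≠ 0)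
    (p : ℕ) (hp : p.Prime) (hpZ : ∀ z ∈ Z, 2 * |z| < (p : ℤ))
    (S : Finset (ZMod p)) (hS0 : (0 : ZMod p) ∉ S)
    (hSfree : ¬ ∃ (x : Fin k → ZMod p) (y : Fin l → ZMod p),
      (∀ i, x i ∈ S) ∧ (∀ j, y j ∈ S) ∧
      ∑ i, (a i : ZMod p) * x i = ∑ j, (b j : ZMod p) * y j) :
    (∃ x : ℕ, x ∈ Finset.Icc 1 (p - 1) ∧ ∃ Z' ⊆ Z,
      ((S.card : ℝ) * (Z.card : ℝ)) / ((p : ℝ) - 1) ≤ (Z'.card : ℝ) ∧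
      ∀ z ∈ Z', ((x : ZMod p) * (z : ZMod p)) ∈ S) ∧
    (∀ x : ℕ, x ∈ Finset.Icc 1 (p - 1) → ∀ Z' : Finset ℤ, Z' ⊆ Z →
      (∀ z ∈ Z', ((x : ZMod p) * (z : ZMod p)) ∈ S) →
      ¬ ∃ (u : Fin k → ℤ) (v : Fin l → ℤ),
        (∀ i, u i ∈ Z') ∧ (∀ j, v j ∈ Z') ∧
        ∑ i, (a i : ℤ) * u i = ∑ j, (b j : ℤ) * v j) := by
  have : Fact p.Prime := ⟨hp⟩
  have hp2 := hp.two_le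
  constructor
  · have hz : ∀ z ∈ Z, (z : ZMod p) ≠ 0 := by
      intro z hzZ h
      rw [ZMod.intCast_zmod_eq_zero_iff_dvd] at h
      have := hpZ z hzZ
      have := abs_nonneg z
      exact hZ0 z hzZ (Int.eq_zero_of_abs_lt_dvd h (by omega))
    have hcount : Z.card * S.card ≤
        ∑ x ∈ Finset.Icc 1 (p - 1), (Z.filter fun z : ℤ => (x : ZMod p) * (z : ZMod p) ∈ S).card := by
      have hswap := Finset.sum_card_bipartiteAbove_eq_sum_card_bipartiteBelow
        (s := Finset.Icc 1 (p - 1)) (t := Z)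
        fun (x : ℕ) (z : ℤ) => (x : ZMod p) * (z : ZMod p) ∈ S
      refine le_of_le_of_eq ?_ hswap.symm
      rw [← smul_eq_mul]
      exact Finset.card_nsmul_le_sum _ _ _ fun z hzZ =>
        card_le_card_filter_dilate_mem hS0 (hz z hzZ)
    have hp1 : (0 : ℝ) < (p : ℝ) - 1 := by
      have : (2 : ℝ) ≤ p := by exact_mod_cast hp2
      linarith
    obtain ⟨x, hx, hle⟩ := Finset.exists_le_of_sum_le
      (s := Finset.Icc 1 (p - 1))
      (f := fun _ => (S.card : ℝ) * (Z.card : ℝ) / ((p : ℝ) - 1))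
      (g := fun x : ℕ => ((Z.filter fun z : ℤ => (x : ZMod p) * (z : ZMod p) ∈ S).card : ℝ))
      ⟨1, by rw [Finset.mem_Icc]; omega⟩ (by
        rw [Finset.sum_const, Nat.card_Icc, Nat.add_sub_cancel, nsmul_eq_mul,
          Nat.cast_sub (by omega), Nat.cast_one, mul_div_cancel₀ _ hp1.ne', mul_comm]
        exact_mod_cast hcount)
    exact ⟨x, hx, _, Finset.filter_subset _ _, hle, fun z hzf => (Finset.mem_filter.1 hzf).2⟩
  · rintro x _ Z' _ hZ' ⟨u, v, hu, hv, huv⟩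
    refine hSfree ⟨fun i => x * (u i : ZMod p), fun j => x * (v j : ZMod p),
      fun i => hZ' _ (hu i), fun j => hZ' _ (hv j), ?_⟩
    have h := congrArg (fun n : ℤ => (x : ZMod p) * (n : ZMod p)) huv
    push_cast [Finset.mul_sum] at h
    simpa only [mul_left_comm] using h
end

section
/- Let a₁,…,a_k and b₁,…,b_ℓ be fixed positive integers with a₁+⋯+a_k ≠ b₁+⋯+b_ℓ (i.e. L is a non-translation-invariant homogeneous linear equation). Then there exist λ > 0 and N ∈ ℕ such that every set Z ⊆ ℤ∖{0} with |Z| = n ≥ N contains an L-free subset of size strictly greater than λn. -/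
/-- Some dilate of a set of nonzero residues meets `R` in at least the average proportion. -/
theorem exists_dilate_card_filter_ge (p : ℕ) [Fact p.Prime] (Z : Finset ℤ)
    (hZ : ∀ z ∈ Z, (z : ZMod p) ≠ 0) (R : Finset (ZMod p)) :
    ∃ t : ZMod p, Z.card * R.card ≤ p * (Z.filter fun z : ℤ => t * (z : ZMod p) ∈ R).card := by
  have hfiber : ∀ z ∈ Z,
      (Finset.univ.filter fun t : ZMod p => t * (z : ZMod p) ∈ R).card = R.card := by
    intro z hz
    refine Finset.card_bij (fun t _ => t * (z : ZMod p)) (fun t ht => (Finset.mem_filter.1 ht).2)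
      (fun s _ t _ h => mul_right_cancel₀ (hZ z hz) h) (fun r hr => ⟨r * (z : ZMod p)⁻¹, ?_, ?_⟩)
    · simpa [inv_mul_cancel_right₀ (hZ z hz)] using hr
    · exact inv_mul_cancel_right₀ (hZ z hz) r
  have hsum : ∑ t : ZMod p, (Z.filter fun z : ℤ => t * (z : ZMod p) ∈ R).card
      = Z.card * R.card := by
    have h := Finset.sum_card_bipartiteAbove_eq_sum_card_bipartiteBelow
      (s := (Finset.univ : Finset (ZMod p))) (t := Z) (fun (t : ZMod p) (z : ℤ) => t * (z : ZMod p) ∈ R)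
    simp only [Finset.bipartiteAbove, Finset.bipartiteBelow] at h
    rw [h, Finset.sum_congr rfl hfiber, Finset.sum_const, smul_eq_mul]
  obtain ⟨t, -, ht⟩ := Finset.exists_max_image (Finset.univ : Finset (ZMod p))
    (fun t => (Z.filter fun z : ℤ => t * (z : ZMod p) ∈ R).card) Finset.univ_nonempty
  refine ⟨t, ?_⟩
  rw [← hsum]
  calc _ ≤ ∑ _s : ZMod p, (Z.filter fun z : ℤ => t * (z : ZMod p) ∈ R).card :=
        Finset.sum_le_sum ht
    _ = _ := by simp [ZMod.card]

/-- There are at least `⌊p / 2C⌋` residues modulo `p` with a representative close to `p / 2D`. -/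
theorem exists_residues_near_fraction (p C D : ℕ) (hD : 0 < D) (hDC : D ≤ C) :
    ∃ R : Finset (ZMod p), R.card = p / (2 * C) ∧
      ∀ r ∈ R, ∃ m : ℤ, (m : ZMod p) = r ∧ C * |2 * D * m - p| < (D : ℤ) * p := by
  have hle : p / (2 * C) ≤ p / (2 * D) := Nat.div_le_div_left (by omega) (by omega)
  refine ⟨(Finset.range (p / (2 * C))).image fun j => ((p / (2 * D) - j : ℕ) : ZMod p), ?_, ?_⟩
  · rw [Finset.card_image_of_injOn, Finset.card_range]
    intro i hi j hj hij
    simp only [Finset.coe_range, Set.mem_Iio] at hi hj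
    have hp : 0 < p := Nat.pos_of_ne_zero (by rintro rfl; simp at hi)
    have hlt : p / (2 * D) < p := Nat.div_lt_self hp (by omega)
    have h := (ZMod.natCast_eq_natCast_iff' _ _ _).1 hij
    rw [Nat.mod_eq_of_lt (by omega), Nat.mod_eq_of_lt (by omega)] at h
    omega
  · intro r hr
    obtain ⟨j, hj, rfl⟩ := Finset.mem_image.1 hr
    rw [Finset.mem_range] at hj
    refine ⟨((p / (2 * D) - j : ℕ) : ℤ), by simp, ?_⟩
    have hdiv := Nat.div_add_mod p (2 * D)
    have hmod := Nat.mod_lt p (show 0 < 2 * D by omega)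
    have hmul : (j + 1) * (2 * C) ≤ p :=
      (Nat.mul_le_mul_right _ hj).trans (Nat.div_mul_le_self p (2 * C))
    rw [Nat.cast_sub (by omega)]
    set q := p / (2 * D)
    set s := p % (2 * D)
    zify at hdiv hmod hmul hD hDC
    have hs : (0 : ℤ) ≤ s := by positivity
    have hj0 : (0 : ℤ) ≤ j := by positivity
    have habs : |2 * (D : ℤ) * (q - j) - p| = s + 2 * D * j := by
      rw [abs_of_nonpos (by nlinarith [mul_nonneg hD.le hj0])]
      linarith
    rw [habs]
    calc (C : ℤ) * (s + 2 * D * j) < C * (2 * D + 2 * D * j) :=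
          mul_lt_mul_of_pos_left (by linarith) (by linarith)
      _ = D * ((j + 1) * (2 * C)) := by ring
      _ ≤ D * p := mul_le_mul_of_nonneg_left hmul hD.le

/-- Integers close to `p / 2|∑ a - ∑ b|` do not solve the equation modulo `p`. -/
theorem not_dvd_sub_of_near_fraction {ι κ : Type*} [Fintype ι] [Fintype κ]
    (a : ι → ℕ) (b : κ → ℕ) (hne : ∑ i, a i ≠ ∑ j, b j) (p : ℕ) (m : ι → ℤ) (n : κ → ℤ)
    (hm : ∀ i, ((∑ i, a i + ∑ j, b j : ℕ) : ℤ) *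
      |2 * (((∑ i, a i : ℕ) : ℤ) - (∑ j, b j : ℕ)).natAbs * m i - p|
        < (((∑ i, a i : ℕ) : ℤ) - (∑ j, b j : ℕ)).natAbs * p)
    (hn : ∀ j, ((∑ i, a i + ∑ j, b j : ℕ) : ℤ) *
      |2 * (((∑ i, a i : ℕ) : ℤ) - (∑ j, b j : ℕ)).natAbs * n j - p|
        < (((∑ i, a i : ℕ) : ℤ) - (∑ j, b j : ℕ)).natAbs * p) :
    ¬ (p : ℤ) ∣ ∑ i, (a i : ℤ) * m i - ∑ j, (b j : ℤ) * n j := by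
  rintro ⟨c, hc⟩
  set A := ∑ i, a i with hA
  set B := ∑ j, b j with hB
  set D := ((A : ℤ) - B).natAbs with hD
  have hDpos : (0 : ℤ) < D := by omega
  have hCpos : (0 : ℤ) < (A + B : ℕ) := by omega
  have hAz : (A : ℤ) = ∑ i, (a i : ℤ) := by rw [hA]; push_cast; rfl
  have hBz : (B : ℤ) = ∑ j, (b j : ℤ) := by rw [hB]; push_cast; rfl
  have hid : 2 * D * (p * c) - ((A : ℤ) - B) * p
      = ∑ i, (a i : ℤ) * (2 * D * m i - p) - ∑ j, (b j : ℤ) * (2 * D * n j - p) := by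
    simp only [mul_sub, Finset.sum_sub_distrib, ← Finset.sum_mul, ← hAz, ← hBz]
    simp only [mul_left_comm _ (2 * (D : ℤ)), ← Finset.mul_sum]
    rw [← hc]
    ring
  have hstrict : ((A + B : ℕ) : ℤ) * |2 * D * (p * c) - ((A : ℤ) - B) * p|
      < (A + B : ℕ) * (D * p) := by
    have hbound : ((A + B : ℕ) : ℤ) * |2 * D * (p * c) - ((A : ℤ) - B) * p|
        ≤ ∑ i, (a i : ℤ) * ((A + B : ℕ) * |2 * D * m i - p|)
          + ∑ j, (b j : ℤ) * ((A + B : ℕ) * |2 * D * n j - p|) := by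
      simp only [mul_left_comm _ ((A + B : ℕ) : ℤ), ← Finset.mul_sum, ← mul_add]
      refine mul_le_mul_of_nonneg_left ?_ hCpos.le
      rw [hid]
      refine (abs_sub _ _).trans (add_le_add ?_ ?_) <;>
      · refine (Finset.abs_sum_le_sum_abs _ _).trans (le_of_eq ?_)
        simp [abs_mul]
    have h1 : ∀ i ∈ Finset.univ, (a i : ℤ) * ((A + B : ℕ) * |2 * D * m i - p|)
        ≤ a i * (D * p - 1) := fun i _ =>
      mul_le_mul_of_nonneg_left (by have := hm i; omega) (by positivity)
    have h2 : ∀ j ∈ Finset.univ, (b j : ℤ) * ((A + B : ℕ) * |2 * D * n j - p|)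
        ≤ b j * (D * p - 1) := fun j _ =>
      mul_le_mul_of_nonneg_left (by have := hn j; omega) (by positivity)
    have h3 := add_le_add (Finset.sum_le_sum h1) (Finset.sum_le_sum h2)
    rw [← Finset.sum_mul, ← Finset.sum_mul, ← hAz, ← hBz, ← add_mul, ← Nat.cast_add] at h3
    exact (hbound.trans h3).trans_lt (mul_lt_mul_of_pos_left (by linarith) hCpos)
  have hlt := lt_of_mul_lt_mul_left hstrict hCpos.le
  have hDp : (0 : ℤ) < D * p := (abs_nonneg _).trans_lt hlt
  rw [abs_lt] at hlt
  rcases (by omega : (A : ℤ) - B = D ∨ (A : ℤ) - B = -D) with h | h <;> rw [h] at hlt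
  · have h1 : 0 < c := by by_contra! hcon; nlinarith [hlt.1]
    nlinarith [hlt.2]
  · have h1 : c < 0 := by by_contra! hcon; nlinarith [hlt.2]
    nlinarith [hlt.1]


/-- For a non-translation-invariant homogeneous equation (`∑ a ≠ ∑ b`),
there exist `λ > 0` and `N` such that every finite set of nonzero integers of size `n ≥ N`
contains an L-free subset of size strictly greater than `λn`. -/
theorem stmt_4 (k l : ℕ) (a : Fin k → ℕ) (b : Fin l → ℕ)
    (ha : ∀ i, 0 < a i) (hb : ∀ j, 0 < b j)
    (hne : ∑ i, a i ≠ ∑ j, b j) :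
    ∃ lam : ℝ, 0 < lam ∧ ∃ N : ℕ, ∀ Z : Finset ℤ,
      (∀ z ∈ Z, z ≠ 0) → N ≤ Z.card →
      ∃ S ⊆ Z, lam * (Z.card : ℝ) < (S.card : ℝ) ∧
        ¬ ∃ (x : Fin k → ℤ) (y : Fin l → ℤ),
          (∀ i, x i ∈ S) ∧ (∀ j, y j ∈ S) ∧
          ∑ i, (a i : ℤ) * x i = ∑ j, (b j : ℤ) * y j := by
  set A := ∑ i, a i with hA
  set B := ∑ j, b j with hB
  set D := ((A : ℤ) - B).natAbs with hD
  have hDpos : 0 < D := by omega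
  have hDC : D ≤ A + B := by omega
  have hCpos : 0 < A + B := by omega
  refine ⟨1 / (4 * (A + B : ℕ)), by positivity, 1, fun Z hZ hcard => ?_⟩
  obtain ⟨p, hple, hp⟩ := Nat.exists_infinite_primes (2 * (A + B) + Z.sup Int.natAbs + 1)
  have := Fact.mk hp
  have hZp : ∀ z ∈ Z, (z : ZMod p) ≠ 0 := by
    intro z hz h
    have h1 := Int.natAbs_dvd_natAbs.2 ((ZMod.intCast_zmod_eq_zero_iff_dvd z p).1 h)
    have h2 := Nat.le_of_dvd (Int.natAbs_pos.2 (hZ z hz)) h1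
    have h3 : z.natAbs ≤ Z.sup Int.natAbs := Finset.le_sup (f := Int.natAbs) hz
    rw [Int.natAbs_natCast] at h2
    omega
  obtain ⟨R, hRcard, hR⟩ := exists_residues_near_fraction p (A + B) D hDpos hDC
  obtain ⟨t, ht⟩ := exists_dilate_card_filter_ge p Z hZp R
  refine ⟨Z.filter fun z : ℤ => t * (z : ZMod p) ∈ R, Finset.filter_subset _ _, ?_, ?_⟩
  · have hk : p < 4 * (A + B) * R.card := by
      have h1 := Nat.lt_mul_div_succ p (show 0 < 2 * (A + B) by omega)
      have h2 : 1 ≤ p / (2 * (A + B)) := (Nat.one_le_div_iff (by omega)).2 (by omega)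
      rw [hRcard]
      nlinarith
    set s := (Z.filter fun z : ℤ => t * (z : ZMod p) ∈ R).card
    have hlt : Z.card < 4 * (A + B) * s := by
      refine Nat.lt_of_mul_lt_mul_left (a := p) ?_
      calc p * Z.card < 4 * (A + B) * R.card * Z.card := Nat.mul_lt_mul_of_pos_right hk hcard
        _ = 4 * (A + B) * (Z.card * R.card) := by ring
        _ ≤ 4 * (A + B) * (p * s) := Nat.mul_le_mul_left _ ht
        _ = p * (4 * (A + B) * s) := by ring
    have hlt' : (Z.card : ℝ) < 4 * (A + B : ℕ) * s := by exact_mod_cast hlt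
    rw [one_div_mul_eq_div, div_lt_iff₀ (by positivity)]
    linarith
  · rintro ⟨x, y, hx, hy, hxy⟩
    choose m hm hm' using fun i => hR _ (Finset.mem_filter.1 (hx i)).2
    choose n hn hn' using fun j => hR _ (Finset.mem_filter.1 (hy j)).2
    refine not_dvd_sub_of_near_fraction a b hne p m n hm' hn' ?_
    rw [← ZMod.intCast_zmod_eq_zero_iff_dvd]
    push_cast
    simp only [hm, hn, mul_left_comm _ t, ← Finset.mul_sum]
    rw [← mul_sub]
    have h := congrArg (Int.cast : ℤ → ZMod p) hxy
    push_cast at h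
    rw [h, sub_self, mul_zero]
end

section
/- With A = A' ∪ A'' as in the construction, for every k ∈ ℕ the number of independent sets of H of cardinality k equals the number of L-free subsets of A of cardinality |A''| + k that contain all elements of A''; indeed, the map I ↦ {b·d^i : i ∈ I} ∪ A'' is a bijection between these two families. -/
/-- Base-`d` expansions of a fixed length with all digits below `d` are unique. -/
theorem digits_eq_of_sum_eq {d : ℕ} (N : ℕ) (f g : ℕ → ℕ) (hf : ∀ p, f p < d)
    (hg : ∀ p, g p < d)
    (h : ∑ p ∈ Finset.range N, f p * d ^ p = ∑ p ∈ Finset.range N, g p * d ^ p) :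
    ∀ p < N, f p = g p := by
  induction N generalizing f g with
  | zero => intro p hp; omega
  | succ N ih =>
    have shift : ∀ u : ℕ → ℕ, ∑ p ∈ Finset.range (N + 1), u p * d ^ p
        = u 0 + d * ∑ p ∈ Finset.range N, u (p + 1) * d ^ p := by
      intro u
      rw [Finset.sum_range_succ', Finset.mul_sum, add_comm, pow_zero, mul_one]
      congr 1
      exact Finset.sum_congr rfl fun p _ => by ring
    rw [shift, shift] at h
    have h0 : f 0 = g 0 := by
      have := congrArg (· % d) h
      simpa [Nat.add_mul_mod_self_left, Nat.mod_eq_of_lt (hf 0), Nat.mod_eq_of_lt (hg 0)]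
        using this
    have hd : 0 < d := (Nat.zero_le _).trans_lt (hf 0)
    have h1 := ih (fun p => f (p + 1)) (fun p => g (p + 1)) (fun p => hf _) (fun p => hg _)
      (Nat.eq_of_mul_eq_mul_left hd (by omega))
    intro p hp
    cases p with
    | zero => exact h0
    | succ p => exact h1 p (by omega)

/-- `c` is a digit sequence of length `N` with digits at most `M` for `z` in base `d`. -/
structure IsDigitSeq (d N M z : ℕ) (c : ℕ → ℕ) : Prop where
  le : ∀ p, c p ≤ M
  eq_zero : ∀ p, N ≤ p → c p = 0
  eq_sum : z = ∑ p ∈ Finset.range N, c p * d ^ p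

theorem IsDigitSeq.value_ext {d N M z w : ℕ} {c : ℕ → ℕ} (hz : IsDigitSeq d N M z c)
    (hw : IsDigitSeq d N M w c) : z = w :=
  hz.eq_sum.trans hw.eq_sum.symm

/-- A linear equation between numbers with small digits holds digit by digit. -/
theorem IsDigitSeq.linear_eq {ι : Type*} [Fintype ι] {d N M y b : ℕ} {x a : ι → ℕ}
    {c : ι → ℕ → ℕ} {cy : ℕ → ℕ} (hc : ∀ j, IsDigitSeq d N M (x j) (c j))
    (hy : IsDigitSeq d N M y cy) (ha : (∑ j, a j) * M < d) (hb : b * M < d)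
    (h : ∑ j, a j * x j = b * y) (p : ℕ) : ∑ j, a j * c j p = b * cy p := by
  rcases lt_or_ge p N with hp | hp
  · refine digits_eq_of_sum_eq (d := d) N (fun p => ∑ j, a j * c j p) (fun p => b * cy p)
      (fun p => lt_of_le_of_lt ?_ ha)
      (fun p => lt_of_le_of_lt (Nat.mul_le_mul_left b (hy.le p)) hb) ?_ p hp
    · rw [Finset.sum_mul]
      exact Finset.sum_le_sum fun j _ => Nat.mul_le_mul_left _ ((hc j).le p)
    · calc ∑ p ∈ Finset.range N, (∑ j, a j * c j p) * d ^ p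
          = ∑ j, a j * x j := by
            simp_rw [Finset.sum_mul]
            rw [Finset.sum_comm]
            refine Finset.sum_congr rfl fun j _ => ?_
            rw [(hc j).eq_sum, Finset.mul_sum]
            exact Finset.sum_congr rfl fun p _ => by ring
        _ = b * y := h
        _ = ∑ p ∈ Finset.range N, b * cy p * d ^ p := by
            rw [hy.eq_sum, Finset.mul_sum]
            exact Finset.sum_congr rfl fun p _ => by ring
  · simp [hy.eq_zero p hp, fun j => (hc j).eq_zero p hp]

theorem isDigitSeq_single {d N M i b : ℕ} (hi : i < N) (hb : b ≤ M) :
    IsDigitSeq d N M (b * d ^ i) (Pi.single i b) where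
  le p := by
    rcases eq_or_ne p i with rfl | h
    · simpa using hb
    · simp [h]
  eq_zero p hp := by simp [show p ≠ i by omega]
  eq_sum := by
    rw [Finset.sum_eq_single i]
    · simp
    · intro p _ h; simp [h]
    · intro h; exact absurd (Finset.mem_range.2 hi) h

/-- The digit sequence with digit `a j` at place `f j`. -/
def placedDigits {ι : Type*} [Fintype ι] (a f : ι → ℕ) (p : ℕ) : ℕ :=
  ∑ j, if f j = p then a j else 0

section placedDigits

variable {ι : Type*} [Fintype ι] {a f : ι → ℕ}

theorem placedDigits_apply (hf : Function.Injective f) (j : ι) :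
    placedDigits a f (f j) = a j := by
  classical
  rw [placedDigits, Finset.sum_eq_single j]
  · simp
  · intro k _ hk; simp [hf.ne hk]
  · simp

theorem placedDigits_eq_zero {p : ℕ} (hp : ∀ j, f j ≠ p) : placedDigits a f p = 0 := by
  simp [placedDigits, hp]

theorem placedDigits_ne_zero_iff (hf : Function.Injective f) (ha : ∀ j, 0 < a j) {p : ℕ} :
    placedDigits a f p ≠ 0 ↔ ∃ j, f j = p := by
  constructor
  · intro h
    by_contra! h'
    exact h (placedDigits_eq_zero h')
  · rintro ⟨j, rfl⟩
    rw [placedDigits_apply hf]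
    exact (ha j).ne'

theorem isDigitSeq_placedDigits {d N M : ℕ} (hf : Function.Injective f) (hN : ∀ j, f j < N)
    (ha : ∀ j, a j ≤ M) : IsDigitSeq d N M (∑ j, a j * d ^ f j) (placedDigits a f) where
  le p := by
    by_cases h : ∃ j, f j = p
    · obtain ⟨j, rfl⟩ := h
      rw [placedDigits_apply hf]
      exact ha j
    · rw [placedDigits_eq_zero (by simpa using h)]
      exact Nat.zero_le _
  eq_zero p hp := placedDigits_eq_zero fun j => ((hN j).trans_le hp).ne
  eq_sum := by
    simp_rw [placedDigits, Finset.sum_mul]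
    rw [Finset.sum_comm]
    refine Finset.sum_congr rfl fun j _ => ?_
    rw [Finset.sum_eq_single (f j)]
    · simp
    · intro p _ h; simp [h.symm]
    · intro h; exact absurd (Finset.mem_range.2 (hN j)) h

end placedDigits

/-- A solution of `∑ aⱼ cⱼ = b c` among the sequences `b · 1ᵢ` (`i ∈ I`) and sequences supported
exactly on the edges of a uniform hypergraph is trivial, or `I` contains an edge. -/
theorem eq_or_exists_subset_of_linear_eq {ι : Type*} [Fintype ι] {a : ι → ℕ} {b : ℕ}
    (hl : 2 ≤ Fintype.card ι) (ha : ∀ j, 0 < a j) (hb : 0 < b)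
    {E : Finset (Finset ℕ)} (hE : ∀ e ∈ E, e.card = Fintype.card ι)
    {g : E → ℕ → ℕ} (hg : ∀ e p, g e p ≠ 0 ↔ p ∈ e.1) {I : Finset ℕ}
    {c : ι → ℕ → ℕ} {cy : ℕ → ℕ}
    (hc : ∀ j, (∃ i ∈ I, c j = Pi.single i b) ∨ ∃ e, c j = g e)
    (hcy : (∃ i ∈ I, cy = Pi.single i b) ∨ ∃ e, cy = g e)
    (h : ∀ p, ∑ j, a j * c j p = b * cy p) :
    (∀ j, c j = cy) ∨ ∃ e ∈ E, e ⊆ I := by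
  classical
  have supp : ∀ j p, c j p ≠ 0 → cy p ≠ 0 := by
    intro j p hjp hp
    have h0 := h p
    rw [hp, mul_zero, Finset.sum_eq_zero_iff] at h0
    rcases Nat.mul_eq_zero.1 (h0 j (Finset.mem_univ j)) with h1 | h1
    · exact (ha j).ne' h1
    · exact hjp h1
  rcases hcy with ⟨i, hi, rfl⟩ | ⟨e, rfl⟩
  · left
    intro j
    have supp' : ∀ p, c j p ≠ 0 → p = i := by
      intro p hp
      by_contra hne
      exact supp j p hp (by simp [hne])
    rcases hc j with ⟨i', -, h'⟩ | ⟨e, h'⟩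
    · rw [h', supp' i' (by simp [h', hb.ne'])]
    · have hsub : e.1 ⊆ {i} := fun p hp =>
        Finset.mem_singleton.2 (supp' p (by rw [h']; exact (hg e p).2 hp))
      have := Finset.card_le_card hsub
      rw [hE e.1 e.2, Finset.card_singleton] at this
      omega
  · have hcj : ∀ j, c j ≠ g e → ∃ i ∈ I, c j = Pi.single i b := by
      intro j hj
      refine (hc j).resolve_right ?_
      rintro ⟨e', he'⟩
      have hsub : e'.1 ⊆ e.1 := fun p hp =>
        (hg e p).1 (supp j p (by rw [he']; exact (hg e' p).2 hp))
      have heq : e' = e := Subtype.ext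
        (Finset.eq_of_subset_of_card_le hsub (by rw [hE _ e.2, hE _ e'.2]))
      exact hj (heq ▸ he')
    choose! idx hidxI hidx using hcj
    by_cases hall : ∀ j, c j ≠ g e
    · right
      refine ⟨e.1, e.2, fun p hp => ?_⟩
      have hpos : ∑ j, a j * c j p ≠ 0 := by
        rw [h p]
        exact mul_ne_zero hb.ne' ((hg e p).2 hp)
      obtain ⟨j, -, hj⟩ := Finset.exists_ne_zero_of_sum_ne_zero hpos
      have hjp : p = idx j := by
        by_contra hne
        exact hj (by rw [hidx j (hall j)]; simp [hne])
      exact hjp ▸ hidxI j (hall j)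
    · left
      push Not at hall
      obtain ⟨j₀, hj₀⟩ := hall
      by_contra! hex
      obtain ⟨j₁, hj₁⟩ := hex
      set K := Finset.univ.filter fun j => c j ≠ g e with hK
      have hKcard : (K.image idx).card < e.1.card := by
        rw [hE _ e.2]
        exact Finset.card_image_le.trans_lt
          (Finset.card_lt_univ_of_notMem (x := j₀) (by simp [hK, hj₀]))
      obtain ⟨p, hpe, hpK⟩ := Finset.exists_mem_notMem_of_card_lt_card hKcard
      have split : ∀ q, (∑ j ∈ Kᶜ, a j) * g e q + ∑ j ∈ K, a j * c j q = b * g e q := by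
        intro q
        rw [← h q, ← Finset.sum_compl_add_sum K, Finset.sum_mul]
        congr 1
        refine Finset.sum_congr rfl fun j hj => ?_
        have : c j = g e := by simpa [hK] using hj
        rw [this]
      have hsum : ∑ j ∈ Kᶜ, a j = b := by
        have hp := split p
        rw [Finset.sum_eq_zero (s := K), add_zero] at hp
        · exact Nat.eq_of_mul_eq_mul_right (Nat.pos_of_ne_zero ((hg e p).2 hpe)) hp
        · intro j hj
          have hne : p ≠ idx j := fun hpj => hpK (hpj ▸ Finset.mem_image_of_mem idx hj)
          rw [hidx j (by simpa [hK] using hj)]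
          simp [hne]
      have hq := split (idx j₁)
      rw [hsum, Nat.add_eq_left, Finset.sum_eq_zero_iff] at hq
      have := hq j₁ (by simpa [hK] using hj₁)
      rw [hidx j₁ hj₁] at this
      simp [(ha j₁).ne', hb.ne'] at this

/-- In the construction `A = A' ∪ A''`, for every `k` the number of independent
sets of `H` of cardinality `k` equals the number of L-free subsets of `A` of cardinality
`|A''| + k` containing all of `A''`; indeed `I ↦ {b·dⁱ : i ∈ I} ∪ A''` is a bijection
between the two families. -/
theorem stmt_9 (ℓ n : ℕ) (hl : 2 ≤ ℓ) (a : Fin ℓ → ℕ) (b : ℕ)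
    (ha : ∀ j, 0 < a j) (hb : 0 < b)
    (E : Finset (Finset ℕ))
    (hEsub : ∀ e ∈ E, e ⊆ Finset.Icc 1 n)
    (hEcard : ∀ e, e ∈ E → e.card = ℓ) (k : ℕ) :
    let d := 2 * ℓ * (Finset.univ.sup a) ^ 2 * b ^ 2
    let A' : Finset ℕ := (Finset.Icc 1 n).image (fun i => b * d ^ i)
    let A'' : Finset ℕ :=
      E.attach.image (fun e => ∑ j, a j * d ^ (e.1.orderEmbOfFin (hEcard e.1 e.2) j))
    let A : Finset ℕ := A' ∪ A''
    let Indep : Set (Finset ℕ) :=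
      {I | I ⊆ Finset.Icc 1 n ∧ I.card = k ∧ ∀ e ∈ E, ¬ e ⊆ I}
    let Good : Set (Finset ℕ) :=
      {S | S ⊆ A ∧ S.card = A''.card + k ∧ A'' ⊆ S ∧
        ¬ ∃ (x : Fin ℓ → ℕ) (y : ℕ), (∀ j, x j ∈ S) ∧ y ∈ S ∧
          ∑ j, a j * x j = b * y ∧ ¬ (∀ j, x j = y)}
    Set.ncard Indep = Set.ncard Good ∧
      Set.BijOn (fun I => I.image (fun i => b * d ^ i) ∪ A'') Indep Good := by
  intro d A' A'' A Indep Good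
  have hl0 : 0 < ℓ := by omega
  set s := Finset.univ.sup a with hs
  have has : ∀ j, a j ≤ s := fun j => Finset.le_sup (Finset.mem_univ j)
  have hs0 : 0 < s := (ha ⟨0, hl0⟩).trans_le (has _)
  have hd : d = 2 * (ℓ * s ^ 2 * b ^ 2) := by simp only [d]; ring
  have hd0 : 0 < ℓ * s ^ 2 * b ^ 2 := by positivity
  have hb_le : b ≤ s * b := Nat.le_mul_of_pos_left b hs0
  have ha_le : ∀ j, a j ≤ s * b := fun j => (has j).trans (Nat.le_mul_of_pos_right s hb)
  have hbd : b * (s * b) < d := by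
    have : b * (s * b) ≤ ℓ * s ^ 2 * b ^ 2 :=
      calc b * (s * b) = (s * b ^ 2) * 1 := by ring
        _ ≤ (s * b ^ 2) * (ℓ * s) := Nat.mul_le_mul_left _ (Nat.mul_pos hl0 hs0)
        _ = ℓ * s ^ 2 * b ^ 2 := by ring
    omega
  have had : (∑ j, a j) * (s * b) < d := by
    have hsum : ∑ j, a j ≤ ℓ * s := by
      simpa using Finset.sum_le_card_nsmul Finset.univ a s fun j _ => has j
    have : (∑ j, a j) * (s * b) ≤ ℓ * s ^ 2 * b ^ 2 :=
      calc (∑ j, a j) * (s * b) ≤ ℓ * s * (s * b) := Nat.mul_le_mul_right _ hsum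
        _ = (ℓ * s ^ 2 * b) * 1 := by ring
        _ ≤ (ℓ * s ^ 2 * b) * b := Nat.mul_le_mul_left _ hb
        _ = ℓ * s ^ 2 * b ^ 2 := by ring
    omega
  have hd1 : 1 < d := by omega
  set pl : E → Fin ℓ → ℕ := fun e j => e.1.orderEmbOfFin (hEcard e.1 e.2) j with hpl
  have hpl_inj : ∀ e, Function.Injective (pl e) := fun e =>
    (e.1.orderEmbOfFin (hEcard e.1 e.2)).injective
  have hpl_mem : ∀ e p, (∃ j, pl e j = p) ↔ p ∈ e.1 := by
    intro e p
    rw [← Finset.mem_coe, ← Finset.range_orderEmbOfFin e.1 (hEcard e.1 e.2)]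
    rfl
  set g : E → ℕ → ℕ := fun e => placedDigits a (pl e) with hgdef
  have hg : ∀ e p, g e p ≠ 0 ↔ p ∈ e.1 := fun e p =>
    (placedDigits_ne_zero_iff (hpl_inj e) ha).trans (hpl_mem e p)
  have hA''mem : ∀ z, z ∈ A'' ↔ ∃ e : E, z = ∑ j, a j * d ^ pl e j := by
    intro z
    simp only [A'', Finset.mem_image, Finset.mem_attach, true_and]
    exact ⟨fun ⟨e, he⟩ => ⟨e, he.symm⟩, fun ⟨e, he⟩ => ⟨e, he.symm⟩⟩
  have dig' : ∀ i ∈ Finset.Icc 1 n, IsDigitSeq d (n + 1) (s * b) (b * d ^ i) (Pi.single i b) :=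
    fun i hi => isDigitSeq_single (Nat.lt_succ_of_le (Finset.mem_Icc.1 hi).2) hb_le
  have dig'' : ∀ e : E, IsDigitSeq d (n + 1) (s * b) (∑ j, a j * d ^ pl e j) (g e) := fun e =>
    isDigitSeq_placedDigits (hpl_inj e) (fun j => Nat.lt_succ_of_le
      (Finset.mem_Icc.1 (hEsub e.1 e.2 ((hpl_mem e _).1 ⟨j, rfl⟩))).2) ha_le
  have hinj : Function.Injective fun i => b * d ^ i := fun i j hij =>
    Nat.pow_right_injective hd1 (Nat.eq_of_mul_eq_mul_left hb hij)
  have hne : ∀ i ∈ Finset.Icc 1 n, b * d ^ i ∉ A'' := by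
    intro i hi hmem
    obtain ⟨e, he⟩ := (hA''mem _).1 hmem
    have hsb : s * b < d := (Nat.le_mul_of_pos_left _ hb).trans_lt hbd
    have heq : ∀ p < n + 1, (Pi.single i b : ℕ → ℕ) p = g e p :=
      digits_eq_of_sum_eq (d := d) (n + 1) _ _ (fun p => ((dig' i hi).le p).trans_lt hsb)
        (fun p => ((dig'' e).le p).trans_lt hsb)
        (by rw [← (dig' i hi).eq_sum, ← (dig'' e).eq_sum, he])
    have hsub : e.1 ⊆ {i} := by
      intro p hp
      rw [Finset.mem_singleton]
      by_contra hpi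
      refine (hg e p).2 hp ?_
      rw [← heq p (Nat.lt_succ_of_le (Finset.mem_Icc.1 (hEsub e.1 e.2 hp)).2)]
      simp [hpi]
    have := Finset.card_le_card hsub
    rw [hEcard e.1 e.2, Finset.card_singleton] at this
    omega
  set F : Finset ℕ → Finset ℕ := fun I => I.image (fun i => b * d ^ i) ∪ A'' with hF
  have hFmem : ∀ I, ∀ i ∈ Finset.Icc 1 n, b * d ^ i ∈ F I ↔ i ∈ I := by
    intro I i hi
    simp only [hF, Finset.mem_union, hne i hi, or_false]
    exact hinj.mem_finset_image
  have hFcard : ∀ I ⊆ Finset.Icc 1 n, (F I).card = A''.card + I.card := by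
    intro I hI
    rw [hF, Finset.card_union_of_disjoint, Finset.card_image_of_injective _ hinj, add_comm]
    rw [Finset.disjoint_left]
    rintro z hz
    obtain ⟨i, hi, rfl⟩ := Finset.mem_image.1 hz
    exact hne i (hI hi)
  have hfree : ∀ I ⊆ Finset.Icc 1 n, ((∀ e ∈ E, ¬ e ⊆ I) ↔
      ¬ ∃ (x : Fin ℓ → ℕ) (y : ℕ), (∀ j, x j ∈ F I) ∧ y ∈ F I ∧
          ∑ j, a j * x j = b * y ∧ ¬ (∀ j, x j = y)) := by
    intro I hI
    have hdig : ∀ z ∈ F I, ∃ c, IsDigitSeq d (n + 1) (s * b) z c ∧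
        ((∃ i ∈ I, c = Pi.single i b) ∨ ∃ e, c = g e) := by
      intro z hz
      rcases Finset.mem_union.1 hz with hz | hz
      · obtain ⟨i, hi, rfl⟩ := Finset.mem_image.1 hz
        exact ⟨_, dig' i (hI hi), Or.inl ⟨i, hi, rfl⟩⟩
      · obtain ⟨e, rfl⟩ := (hA''mem z).1 hz
        exact ⟨_, dig'' e, Or.inr ⟨e, rfl⟩⟩
    constructor
    · rintro hind ⟨x, y, hx, hy, heq, hnt⟩
      choose c hc hc' using fun j => hdig (x j) (hx j)
      obtain ⟨cy, hcy, hcy'⟩ := hdig y hy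
      rcases eq_or_exists_subset_of_linear_eq (by simpa using hl) ha hb
          (fun e he => by simpa using hEcard e he) hg hc' hcy'
          (IsDigitSeq.linear_eq hc hcy had hbd heq) with h | ⟨e, he, heI⟩
      · exact hnt fun j => (h j ▸ hc j).value_ext hcy
      · exact hind e he heI
    · rintro hno e he heI
      have hmem : ∀ j, pl ⟨e, he⟩ j ∈ I := fun j => heI ((hpl_mem ⟨e, he⟩ _).1 ⟨j, rfl⟩)
      have hy : ∑ j, a j * d ^ pl ⟨e, he⟩ j ∈ A'' := (hA''mem _).2 ⟨_, rfl⟩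
      refine hno ⟨fun j => b * d ^ pl ⟨e, he⟩ j, ∑ j, a j * d ^ pl ⟨e, he⟩ j,
        fun j => (hFmem I _ (hI (hmem j))).2 (hmem j), Finset.mem_union_right _ hy, ?_, ?_⟩
      · rw [Finset.mul_sum]
        exact Finset.sum_congr rfl fun j _ => by ring
      · intro hall
        refine hne _ (hI (hmem ⟨0, hl0⟩)) ?_
        rw [← hall ⟨0, hl0⟩] at hy
        exact hy
  have hbij : Set.BijOn F Indep Good := by
    refine ⟨?_, ?_, ?_⟩
    · rintro I ⟨hI, hk, hind⟩
      exact ⟨Finset.union_subset_union_left (Finset.image_subset_image hI),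
        by rw [hFcard I hI, hk], Finset.subset_union_right, (hfree I hI).1 hind⟩
    · rintro I ⟨hI, -, -⟩ J ⟨hJ, -, -⟩ hIJ
      ext i
      by_cases hi : i ∈ Finset.Icc 1 n
      · rw [← hFmem I i hi, ← hFmem J i hi, hIJ]
      · exact ⟨fun h => absurd (hI h) hi, fun h => absurd (hJ h) hi⟩
    · rintro S ⟨hSA, hcard, hA''S, hSfree⟩
      set I := (Finset.Icc 1 n).filter fun i => b * d ^ i ∈ S with hIdef
      have hI : I ⊆ Finset.Icc 1 n := Finset.filter_subset _ _
      have hFI : F I = S := by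
        ext z
        constructor
        · intro hz
          rcases Finset.mem_union.1 hz with hz | hz
          · obtain ⟨i, hi, rfl⟩ := Finset.mem_image.1 hz
            exact (Finset.mem_filter.1 hi).2
          · exact hA''S hz
        · intro hz
          rcases Finset.mem_union.1 (hSA hz) with hz' | hz'
          · obtain ⟨i, hi, rfl⟩ := Finset.mem_image.1 hz'
            exact (hFmem I i hi).2 (Finset.mem_filter.2 ⟨hi, hz⟩)
          · exact Finset.mem_union_right _ hz'
      refine ⟨I, ⟨hI, ?_, (hfree I hI).2 (by rw [hFI]; exact hSfree)⟩, hFI⟩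
      have := hFcard I hI
      rw [hFI] at this
      omega
  refine ⟨?_, hbij⟩
  rw [← hbij.image_eq, hbij.injOn.ncard_image]
end

section
/- With A = A' ∪ A'' as in the construction, for every k ∈ ℕ the hypergraph H contains an independent set of cardinality k if and only if A contains an L-free subset of cardinality |A''| + k. -/
/-- Base-`d` expansions of length `N` are unique. -/
theorem digits_unique {d : ℕ} (N : ℕ) (f g : ℕ → ℕ)
    (hf : ∀ i, f i < d) (hg : ∀ i, g i < d)
    (h : ∑ i ∈ Finset.range N, f i * d ^ i = ∑ i ∈ Finset.range N, g i * d ^ i) :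
    ∀ i < N, f i = g i := by
  induction N generalizing f g with
  | zero => intro i hi; omega
  | succ N ih =>
    have key : ∀ u : ℕ → ℕ, ∑ i ∈ Finset.range (N + 1), u i * d ^ i
        = u 0 + d * ∑ i ∈ Finset.range N, u (i + 1) * d ^ i := by
      intro u
      rw [Finset.sum_range_succ', Finset.mul_sum, add_comm]
      congr 1
      · simp
      · exact Finset.sum_congr rfl fun i _ => by ring
    rw [key f, key g] at h
    have hd : 0 < d := (Nat.zero_le _).trans_lt (hf 0)
    have h0 : f 0 = g 0 := by
      have := congrArg (· % d) h
      simpa [Nat.add_mul_mod_self_left, Nat.mod_eq_of_lt (hf 0), Nat.mod_eq_of_lt (hg 0)] using this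
    have h1 := ih (fun i => f (i + 1)) (fun i => g (i + 1)) (fun i => hf _) (fun i => hg _)
      (Nat.eq_of_mul_eq_mul_left hd (by omega))
    intro i hi
    cases i with
    | zero => exact h0
    | succ i => exact h1 i (by omega)

/-- The `i`-th digit of the number attached to the edge `e`. -/
def edgeDigit {ℓ : ℕ} (a : Fin ℓ → ℕ) (e : Finset ℕ) (h : e.card = ℓ) (i : ℕ) : ℕ :=
  ∑ j, if e.orderEmbOfFin h j = i then a j else 0

section edgeDigit

variable {ℓ : ℕ} {a : Fin ℓ → ℕ} {e : Finset ℕ} (h : e.card = ℓ)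

theorem edgeDigit_apply (j : Fin ℓ) : edgeDigit a e h (e.orderEmbOfFin h j) = a j := by
  simp [edgeDigit]

theorem edgeDigit_of_notMem {i : ℕ} (hi : i ∉ e) : edgeDigit a e h i = 0 :=
  Finset.sum_eq_zero fun j _ =>
    if_neg fun hj : e.orderEmbOfFin h j = i => hi (hj ▸ Finset.orderEmbOfFin_mem e h j)

theorem exists_orderEmbOfFin_eq {i : ℕ} (hi : i ∈ e) : ∃ j, e.orderEmbOfFin h j = i := by
  have : i ∈ Set.range (e.orderEmbOfFin h) := by
    rw [Finset.range_orderEmbOfFin]; exact hi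
  exact this

theorem edgeDigit_pos_iff (ha : ∀ j, 0 < a j) {i : ℕ} : 0 < edgeDigit a e h i ↔ i ∈ e := by
  constructor
  · intro hp
    by_contra hi
    simp [edgeDigit_of_notMem h hi] at hp
  · intro hi
    obtain ⟨j, rfl⟩ := exists_orderEmbOfFin_eq h hi
    rw [edgeDigit_apply]
    exact ha j

theorem edgeDigit_le (i : ℕ) : edgeDigit a e h i ≤ Finset.univ.sup a := by
  by_cases hi : i ∈ e
  · obtain ⟨j, rfl⟩ := exists_orderEmbOfFin_eq h hi
    rw [edgeDigit_apply]
    exact Finset.le_sup (Finset.mem_univ j)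
  · simp [edgeDigit_of_notMem h hi]

theorem sum_edgeDigit_mul_pow {n : ℕ} (he : e ⊆ Finset.Icc 1 n) (d : ℕ) :
    ∑ i ∈ Finset.range (n + 1), edgeDigit a e h i * d ^ i
      = ∑ j, a j * d ^ (e.orderEmbOfFin h j) := by
  simp only [edgeDigit, Finset.sum_mul]
  rw [Finset.sum_comm]
  refine Finset.sum_congr rfl fun j _ => ?_
  have hj := Finset.mem_Icc.1 (he (Finset.orderEmbOfFin_mem e h j))
  simp only [ite_mul, zero_mul]
  rw [Finset.sum_ite_eq, if_pos (Finset.mem_range.2 (by omega))]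

end edgeDigit

theorem sum_single_mul_pow {n p : ℕ} (hp : p ∈ Finset.Icc 1 n) (b d : ℕ) :
    ∑ i ∈ Finset.range (n + 1), (Pi.single p b : ℕ → ℕ) i * d ^ i = b * d ^ p := by
  have := Finset.mem_Icc.1 hp
  rw [Finset.sum_eq_single p]
  · simp
  · intro i _ hi; simp [hi]
  · intro h; exact absurd (Finset.mem_range.2 (by omega)) h

/-- `w` is the digit function of an element of `A' ∪ A''`. -/
def IsDigitFun {ℓ : ℕ} (n : ℕ) (a : Fin ℓ → ℕ) (b : ℕ) (E : Finset (Finset ℕ))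
    (w : ℕ → ℕ) : Prop :=
  (∃ p ∈ Finset.Icc 1 n, w = Pi.single p b) ∨
    ∃ e ∈ E, ∃ h : e.card = ℓ, w = edgeDigit a e h

section IsDigitFun

variable {ℓ n : ℕ} {a : Fin ℓ → ℕ} {b : ℕ} {E : Finset (Finset ℕ)}

theorem IsDigitFun.le {w : ℕ → ℕ} (hw : IsDigitFun n a b E w) (i : ℕ) :
    w i ≤ max (Finset.univ.sup a) b := by
  rcases hw with ⟨p, _, rfl⟩ | ⟨e, _, h, rfl⟩
  · refine le_trans ?_ (le_max_right _ _)
    by_cases hi : i = p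
    · subst hi; simp
    · simp [hi]
  · exact (edgeDigit_le h i).trans (le_max_left _ _)

theorem IsDigitFun.eq_zero (hE : ∀ e ∈ E, e ⊆ Finset.Icc 1 n) {w : ℕ → ℕ}
    (hw : IsDigitFun n a b E w) {i : ℕ} (hi : n < i) : w i = 0 := by
  rcases hw with ⟨p, hp, rfl⟩ | ⟨e, he, h, rfl⟩
  · have := Finset.mem_Icc.1 hp
    simp [show i ≠ p by omega]
  · refine edgeDigit_of_notMem h fun hie => ?_
    have := Finset.mem_Icc.1 (hE e he hie)
    omega

theorem edgeDigit_ne_single (hl : 2 ≤ ℓ) (ha : ∀ j, 0 < a j) {e : Finset ℕ} (h : e.card = ℓ)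
    (p : ℕ) (c : ℕ) : edgeDigit a e h ≠ Pi.single p c := by
  intro heq
  obtain ⟨q, hq, hqp⟩ := Finset.exists_mem_ne (s := e) (by omega) p
  have hpos := (edgeDigit_pos_iff h ha).2 hq
  rw [heq] at hpos
  simp [hqp] at hpos

theorem edgeDigit_injective (ha : ∀ j, 0 < a j) {e e' : Finset ℕ} (h : e.card = ℓ)
    (h' : e'.card = ℓ) (heq : edgeDigit a e h = edgeDigit a e' h') : e = e' := by
  ext i
  rw [← edgeDigit_pos_iff h ha, ← edgeDigit_pos_iff h' ha, heq]

/-- Digitwise solutions of the equation are trivial or come from an edge. -/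
theorem digit_solution (hl : 2 ≤ ℓ) (ha : ∀ j, 0 < a j) (hb : 0 < b)
    {X : Fin ℓ → ℕ → ℕ} {Y : ℕ → ℕ} (hX : ∀ j, IsDigitFun n a b E (X j))
    (hY : IsDigitFun n a b E Y) (heq : ∀ i, ∑ j, a j * X j i = b * Y i) :
    (∀ j, X j = Y) ∨ ∃ e ∈ E, ∃ h : e.card = ℓ, Y = edgeDigit a e h ∧
      ∀ i ∈ e, ∃ j, X j = Pi.single i b := by
  have supp : ∀ j i, 0 < X j i → 0 < Y i := by
    intro j i hji
    have h1 : a j * X j i ≤ ∑ j, a j * X j i :=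
      Finset.single_le_sum (f := fun j => a j * X j i) (fun _ _ => Nat.zero_le _)
        (Finset.mem_univ j)
    rw [heq] at h1
    exact Nat.pos_of_mul_pos_left (lt_of_lt_of_le (Nat.mul_pos (ha j) hji) h1)
  rcases hY with ⟨p, _, rfl⟩ | ⟨e, he, h, rfl⟩
  · left
    intro j
    have hp : ∀ i, 0 < X j i → i = p := by
      intro i hi
      by_contra hne
      simpa [hne] using supp j i hi
    rcases hX j with ⟨q, _, hq⟩ | ⟨f, _, hf, hq⟩
    · have : q = p := hp q (by simp [hq, hb])
      rw [hq, this]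
    · exfalso
      obtain ⟨r, hr, hrp⟩ := Finset.exists_mem_ne (s := f) (by omega) p
      exact hrp (hp r (by rw [hq]; exact (edgeDigit_pos_iff hf ha).2 hr))
  · have cases_X : ∀ j, X j = edgeDigit a e h ∨ ∃ q ∈ e, X j = Pi.single q b := by
      intro j
      rcases hX j with ⟨q, _, hq⟩ | ⟨f, _, hf, hq⟩
      · exact Or.inr ⟨q, (edgeDigit_pos_iff h ha).1 (supp j q (by simp [hq, hb])), hq⟩
      · left
        have hsub : f ⊆ e := fun i hi => (edgeDigit_pos_iff h ha).1
          (supp j i (by rw [hq]; exact (edgeDigit_pos_iff hf ha).2 hi))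
        obtain rfl : f = e := Finset.eq_of_subset_of_card_le hsub (by omega)
        exact hq
    by_cases hall : ∀ j, X j = edgeDigit a e h
    · exact Or.inl hall
    right
    refine ⟨e, he, h, rfl, ?_⟩
    by_contra hcon
    push Not at hcon
    obtain ⟨i, hi, hmiss⟩ := hcon
    push Not at hall
    obtain ⟨j₀, hj₀⟩ := hall
    obtain ⟨q, hqe, hq⟩ := (cases_X j₀).resolve_left hj₀
    classical
    let c := ∑ j, if X j = edgeDigit a e h then a j else 0
    -- at the missed position `i` only copies of `y` contribute, so their coefficients sum to `b`
    have hci : c * edgeDigit a e h i = b * edgeDigit a e h i := by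
      rw [← heq i, Finset.sum_mul]
      refine Finset.sum_congr rfl fun j _ => ?_
      split_ifs with hj
      · rw [hj]
      · obtain ⟨r, _, hr⟩ := (cases_X j).resolve_left hj
        have : i ≠ r := fun hir => hmiss j (by rw [hr, hir])
        simp [hr, this]
    have hc : c = b := Nat.eq_of_mul_eq_mul_right ((edgeDigit_pos_iff h ha).2 hi) hci
    have hlt : c * edgeDigit a e h q < b * edgeDigit a e h q := by
      rw [← heq q, Finset.sum_mul]
      refine Finset.sum_lt_sum (fun j _ => ?_) ⟨j₀, Finset.mem_univ _, ?_⟩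
      · split_ifs with hj
        · rw [hj]
        · simp
      · rw [if_neg hj₀, hq]
        simpa using Nat.mul_pos (ha j₀) hb
    rw [hc] at hlt
    exact lt_irrefl _ hlt

/-- The base `2ℓM²b²` is large enough that solutions can be read off digitwise. -/
theorem solution_digits (hl : 2 ≤ ℓ) (ha : ∀ j, 0 < a j) (hb : 0 < b)
    (hE : ∀ e ∈ E, e ⊆ Finset.Icc 1 n) {d : ℕ}
    (hd : d = 2 * ℓ * (Finset.univ.sup a) ^ 2 * b ^ 2)
    {X : Fin ℓ → ℕ → ℕ} {Y : ℕ → ℕ} (hX : ∀ j, IsDigitFun n a b E (X j))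
    (hY : IsDigitFun n a b E Y)
    (heq : ∑ j, a j * ∑ i ∈ Finset.range (n + 1), X j i * d ^ i
      = b * ∑ i ∈ Finset.range (n + 1), Y i * d ^ i) (i : ℕ) :
    ∑ j, a j * X j i = b * Y i := by
  by_cases hi : n < i
  · rw [hY.eq_zero hE hi]
    simp [fun j => (hX j).eq_zero hE hi]
  set M := Finset.univ.sup a with hM
  have hM0 : 0 < M := (ha ⟨0, by omega⟩).trans_le (Finset.le_sup (Finset.mem_univ _))
  have hmax : max M b ≤ M * b :=
    max_le (Nat.le_mul_of_pos_right _ hb) (Nat.le_mul_of_pos_left _ hM0)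
  have hpos : 0 < ℓ * M ^ 2 * b ^ 2 := by positivity
  have hf : ∀ i, ∑ j, a j * X j i < d := by
    intro i
    calc ∑ j, a j * X j i ≤ ∑ _j : Fin ℓ, M * (M * b) :=
          Finset.sum_le_sum fun j _ =>
            Nat.mul_le_mul (Finset.le_sup (Finset.mem_univ j)) (((hX j).le i).trans hmax)
      _ = ℓ * M ^ 2 * b := by simp; ring
      _ ≤ ℓ * M ^ 2 * b ^ 2 := Nat.mul_le_mul_left _ (Nat.le_self_pow two_ne_zero b)
      _ < d := by rw [hd]; linarith
  have hg : ∀ i, b * Y i < d := by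
    intro i
    calc b * Y i ≤ b * (M * b) := Nat.mul_le_mul_left _ ((hY.le i).trans hmax)
      _ = M * b ^ 2 := by ring
      _ ≤ M ^ 2 * b ^ 2 := Nat.mul_le_mul_right _ (Nat.le_self_pow two_ne_zero M)
      _ ≤ ℓ * (M ^ 2 * b ^ 2) := Nat.le_mul_of_pos_left _ (by omega)
      _ < d := by rw [hd]; linarith
  refine digits_unique (n + 1) (fun i => ∑ j, a j * X j i) (fun i => b * Y i) hf hg ?_ i (by omega)
  simp only [Finset.mul_sum] at heq
  rw [Finset.sum_comm] at heq
  simpa only [Finset.sum_mul, mul_assoc] using heq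

/-- Numbers in `A' ∪ A''` determine their digit functions. -/
theorem IsDigitFun.ext_of_sum_eq (hl : 2 ≤ ℓ) (ha : ∀ j, 0 < a j) (hb : 0 < b)
    (hE : ∀ e ∈ E, e ⊆ Finset.Icc 1 n) {d : ℕ}
    (hd : d = 2 * ℓ * (Finset.univ.sup a) ^ 2 * b ^ 2) {u w : ℕ → ℕ}
    (hu : IsDigitFun n a b E u) (hw : IsDigitFun n a b E w)
    (heq : ∑ i ∈ Finset.range (n + 1), u i * d ^ i
      = ∑ i ∈ Finset.range (n + 1), w i * d ^ i) : u = w := by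
  have hM0 : 0 < Finset.univ.sup a :=
    (ha ⟨0, by omega⟩).trans_le (Finset.le_sup (Finset.mem_univ _))
  have hmax : max (Finset.univ.sup a) b < d := by
    have h1 : max (Finset.univ.sup a) b ≤ Finset.univ.sup a * b :=
      max_le (Nat.le_mul_of_pos_right _ hb) (Nat.le_mul_of_pos_left _ hM0)
    have h2 : Finset.univ.sup a * b ≤ (Finset.univ.sup a * b) ^ 2 := Nat.le_self_pow two_ne_zero _
    have h3 : 0 < (Finset.univ.sup a * b) ^ 2 := by positivity
    have h4 : d = ℓ * 2 * (Finset.univ.sup a * b) ^ 2 := by rw [hd]; ring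
    nlinarith
  funext i
  by_cases hi : n < i
  · rw [hu.eq_zero hE hi, hw.eq_zero hE hi]
  · exact digits_unique (n + 1) u w (fun i => (hu.le i).trans_lt hmax)
      (fun i => (hw.le i).trans_lt hmax) heq i (by omega)

end IsDigitFun


/-- In the construction `A = A' ∪ A''`, for every `k` the hypergraph `H` has
an independent set of cardinality `k` iff `A` contains an L-free subset of cardinality
`|A''| + k`. -/
theorem stmt_10 (ℓ n : ℕ) (hl : 2 ≤ ℓ) (a : Fin ℓ → ℕ) (b : ℕ)
    (ha : ∀ j, 0 < a j) (hb : 0 < b)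
    (E : Finset (Finset ℕ))
    (hEsub : ∀ e ∈ E, e ⊆ Finset.Icc 1 n)
    (hEcard : ∀ e, e ∈ E → e.card = ℓ) (k : ℕ) :
    let d := 2 * ℓ * (Finset.univ.sup a) ^ 2 * b ^ 2
    let A' : Finset ℕ := (Finset.Icc 1 n).image (fun i => b * d ^ i)
    let A'' : Finset ℕ :=
      E.attach.image (fun e => ∑ j, a j * d ^ (e.1.orderEmbOfFin (hEcard e.1 e.2) j))
    let A : Finset ℕ := A' ∪ A''
    ((∃ I : Finset ℕ, I ⊆ Finset.Icc 1 n ∧ I.card = k ∧ ∀ e ∈ E, ¬ e ⊆ I) ↔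
      (∃ S : Finset ℕ, S ⊆ A ∧ S.card = A''.card + k ∧
        ¬ ∃ (x : Fin ℓ → ℕ) (y : ℕ), (∀ j, x j ∈ S) ∧ y ∈ S ∧
          ∑ j, a j * x j = b * y ∧ ¬ (∀ j, x j = y))) := by
  intro d A' A'' A
  let v : {e // e ∈ E} → ℕ :=
    fun e => ∑ j, a j * d ^ (e.1.orderEmbOfFin (hEcard e.1 e.2) j)
  have hv : ∀ e : {e // e ∈ E}, ∑ i ∈ Finset.range (n + 1),
      edgeDigit a e.1 (hEcard e.1 e.2) i * d ^ i = v e :=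
    fun e => sum_edgeDigit_mul_pow _ (hEsub e.1 e.2) d
  have dig_v : ∀ e : {e // e ∈ E}, IsDigitFun n a b E (edgeDigit a e.1 (hEcard e.1 e.2)) :=
    fun e => Or.inr ⟨e.1, e.2, hEcard e.1 e.2, rfl⟩
  have dig_p : ∀ p ∈ Finset.Icc 1 n, IsDigitFun n a b E (Pi.single p b) :=
    fun p hp => Or.inl ⟨p, hp, rfl⟩
  have hM0 : 0 < Finset.univ.sup a :=
    (ha ⟨0, by omega⟩).trans_le (Finset.le_sup (Finset.mem_univ _))
  have hv_inj : Function.Injective v := by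
    intro e e' hee
    rw [← hv, ← hv] at hee
    exact Subtype.ext (edgeDigit_injective ha _ _
      ((dig_v e).ext_of_sum_eq hl ha hb hEsub rfl (dig_v e') hee))
  have hv_ne : ∀ e, ∀ p ∈ Finset.Icc 1 n, v e ≠ b * d ^ p := by
    intro e p hp hep
    rw [← hv, ← sum_single_mul_pow hp] at hep
    exact edgeDigit_ne_single hl ha _ p b
      ((dig_v e).ext_of_sum_eq hl ha hb hEsub rfl (dig_p p hp) hep)
  have hd : 1 < d := by
    have : 0 < (Finset.univ.sup a) ^ 2 * b ^ 2 := by positivity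
    have : d = ℓ * 2 * ((Finset.univ.sup a) ^ 2 * b ^ 2) := by simp only [d]; ring
    nlinarith
  have hp_inj : Function.Injective fun i : ℕ => b * d ^ i := fun i j hij =>
    Nat.pow_right_injective hd (Nat.eq_of_mul_eq_mul_left hb hij)
  have digits_A : ∀ x ∈ A, ∃ w, IsDigitFun n a b E w ∧
      x = ∑ i ∈ Finset.range (n + 1), w i * d ^ i := by
    intro x hx
    rcases Finset.mem_union.1 hx with hx | hx
    · obtain ⟨p, hp, rfl⟩ := Finset.mem_image.1 hx
      exact ⟨_, dig_p p hp, (sum_single_mul_pow hp b d).symm⟩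
    · obtain ⟨e, _, rfl⟩ := Finset.mem_image.1 hx
      exact ⟨_, dig_v e, (hv e).symm⟩
  constructor
  · rintro ⟨I, hI, rfl, hind⟩
    have hIA : I.image (fun i => b * d ^ i) ⊆ A' := Finset.image_subset_image hI
    have hSA : A'' ∪ I.image (fun i => b * d ^ i) ⊆ A :=
      Finset.union_subset Finset.subset_union_right (hIA.trans Finset.subset_union_left)
    refine ⟨A'' ∪ I.image (fun i => b * d ^ i), hSA, ?_, ?_⟩
    · rw [Finset.card_union_of_disjoint, Finset.card_image_of_injective _ hp_inj]
      rw [Finset.disjoint_left]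
      intro x hx hx'
      obtain ⟨e, _, rfl⟩ := Finset.mem_image.1 hx
      obtain ⟨p, hp, hpe⟩ := Finset.mem_image.1 hx'
      exact hv_ne e p (hI hp) hpe.symm
    · rintro ⟨x, y, hx, hy, hxy, hne⟩
      choose X hX hxX using fun j => digits_A (x j) (hSA (hx j))
      obtain ⟨Y, hY, hyY⟩ := digits_A y (hSA hy)
      simp only [hxX, hyY] at hxy
      rcases digit_solution hl ha hb hX hY (solution_digits hl ha hb hEsub rfl hX hY hxy) with
        h | ⟨e, he, h, -, hcov⟩
      · exact hne fun j => by rw [hxX, hyY, h]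
      · refine hind e he fun i hi => ?_
        have hin := hEsub e he hi
        obtain ⟨j, hj⟩ := hcov i hi
        have hxj : x j = b * d ^ i := by rw [hxX, hj, sum_single_mul_pow hin]
        rcases Finset.mem_union.1 (hx j) with hx' | hx'
        · obtain ⟨f, _, hf⟩ := Finset.mem_image.1 hx'
          exact absurd (hf.trans hxj) (hv_ne f i hin)
        · obtain ⟨p, hp, hpe⟩ := Finset.mem_image.1 hx'
          rwa [← hp_inj (hpe.trans hxj)]
  · rintro ⟨S, hSA, hcard, hfree⟩
    let I₀ := (Finset.Icc 1 n).filter fun i => b * d ^ i ∈ S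
    let F := E.attach.filter fun e => e.1 ⊆ I₀
    have hFS : ∀ e ∈ F, v e ∉ S := by
      intro e he hve
      have heI : e.1 ⊆ I₀ := (Finset.mem_filter.1 he).2
      refine hfree ⟨fun j => b * d ^ (e.1.orderEmbOfFin (hEcard e.1 e.2) j), v e,
        fun j => (Finset.mem_filter.1 (heI (Finset.orderEmbOfFin_mem _ _ j))).2, hve, ?_, ?_⟩
      · simp only [v, Finset.mul_sum]
        exact Finset.sum_congr rfl fun j _ => by ring
      · intro h
        exact hv_ne e _ (hEsub e.1 e.2 (Finset.orderEmbOfFin_mem _ (hEcard e.1 e.2) ⟨0, by omega⟩))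
          (h ⟨0, by omega⟩).symm
    have hS_sub : S ⊆ I₀.image (fun i => b * d ^ i) ∪ (A'' \ F.image v) := by
      intro s hs
      rcases Finset.mem_union.1 (hSA hs) with h | h
      · obtain ⟨p, hp, rfl⟩ := Finset.mem_image.1 h
        exact Finset.mem_union_left _
          (Finset.mem_image_of_mem _ (Finset.mem_filter.2 ⟨hp, hs⟩))
      · refine Finset.mem_union_right _ (Finset.mem_sdiff.2 ⟨h, fun h' => ?_⟩)
        obtain ⟨e, he, rfl⟩ := Finset.mem_image.1 h'
        exact hFS e he hs
    have hFA : F.image v ⊆ A'' := Finset.image_subset_image (Finset.filter_subset _ _)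
    have hFcard : (F.image v).card = F.card := Finset.card_image_of_injective _ hv_inj
    have hI₀card : k + F.card ≤ I₀.card := by
      have h1 := (Finset.card_le_card hS_sub).trans (Finset.card_union_le _ _)
      rw [Finset.card_image_of_injective _ hp_inj, Finset.card_sdiff_of_subset hFA] at h1
      have h2 := Finset.card_le_card hFA
      omega
    have hne : ∀ e : {e // e ∈ E}, ∃ i, i ∈ e.1 := fun e =>
      Finset.card_pos.1 (by rw [hEcard e.1 e.2]; omega)
    choose r hr using hne
    obtain ⟨I, hI, hIk⟩ := Finset.exists_subset_card_eq (s := I₀ \ F.image r) (n := k) (by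
      have h1 := Finset.le_card_sdiff (F.image r) I₀
      have h2 : (F.image r).card ≤ F.card := Finset.card_image_le
      omega)
    refine ⟨I, fun i hi => (Finset.mem_filter.1 (Finset.mem_sdiff.1 (hI hi)).1).1, hIk, ?_⟩
    intro e he heI
    have heF : (⟨e, he⟩ : {e // e ∈ E}) ∈ F :=
      Finset.mem_filter.2 ⟨Finset.mem_attach _ _, fun i hi => (Finset.mem_sdiff.1 (hI (heI hi))).1⟩
    exact (Finset.mem_sdiff.1 (hI (heI (hr ⟨e, he⟩)))).2 (Finset.mem_image_of_mem _ heF)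
end

section
/- Let a, b, c be fixed positive integers with a + b = c and a ≤ b. Let x₁ < x₂ < x₃ be positive integers and suppose (x, y, z) is a solution to ax + by = cz where (x, y, z) is some permutation of (x₁, x₂, x₃). Then z = x₂, and moreover c·x₂ > a·x₃. -/
/-- If `a + b = c`, `a ≤ b`, and positive integers `x₁ < x₂ < x₃` form (in
some order `(x,y,z)`) a solution to `ax + by = cz`, then `z = x₂` and `c·x₂ > a·x₃`. -/
theorem stmt_11 (a b c : ℕ) (ha : 0 < a) (hb : 0 < b) (hc : 0 < c)
    (habc : a + b = c) (hab : a ≤ b)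
    (x₁ x₂ x₃ : ℕ) (h1 : 0 < x₁) (h12 : x₁ < x₂) (h23 : x₂ < x₃)
    (x y z : ℕ) (hperm : ({x, y, z} : Multiset ℕ) = ({x₁, x₂, x₃} : Multiset ℕ))
    (heq : a * x + b * y = c * z) :
    z = x₂ ∧ a * x₃ < c * x₂ := by
  have m₁ : x₁ ∈ ({x, y, z} : Multiset ℕ) := by rw [hperm]; simp
  have m₂ : x₂ ∈ ({x, y, z} : Multiset ℕ) := by rw [hperm]; simp
  have m₃ : x₃ ∈ ({x, y, z} : Multiset ℕ) := by rw [hperm]; simp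
  simp only [Multiset.insert_eq_cons, Multiset.mem_cons, Multiset.mem_singleton] at m₁ m₂ m₃
  subst habc
  have hb₁ : 0 < b * x₁ := Nat.mul_pos hb h1
  have ha₁ : 0 < a * x₁ := Nat.mul_pos ha h1
  have a12 := Nat.mul_lt_mul_of_pos_left h12 ha
  have a23 := Nat.mul_lt_mul_of_pos_left h23 ha
  have b12 := Nat.mul_lt_mul_of_pos_left h12 hb
  have b23 := Nat.mul_lt_mul_of_pos_left h23 hb
  have hab₃ := Nat.mul_le_mul_right x₃ hab
  rw [add_mul] at heq ⊢
  rcases m₁ with rfl | rfl | rfl <;> rcases m₂ with rfl | rfl | rfl <;>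
    rcases m₃ with rfl | rfl | rfl <;> omega
end

section
/- Let a, b, c be fixed positive integers with a + b ≠ c. Then there is a constant K, depending only on a, b, c, with the following property: for every nonempty finite set A of positive integers and every t ∈ ℕ with t > |A|, there exists a finite set B of positive integers such that (i) |B| = t; (ii) A ⊆ B; (iii) every triple (x, y, z) ∈ B³ with ax + by = cz satisfies x, y, z ∈ A; and (iv) max(B) ≤ K·t·(max(A))². -/
/-- Modulo `a + b + c`, the residue class of `1` contains no solution to `ax + by = cz`. -/
theorem ne_of_modEq_one {a b c x y z : ℕ} (ha : 0 < a) (hc : 0 < c) (habc : a + b ≠ c)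
    (hx : x ≡ 1 [MOD a + b + c]) (hy : y ≡ 1 [MOD a + b + c]) (hz : z ≡ 1 [MOD a + b + c]) :
    a * x + b * y ≠ c * z := by
  intro h
  have h₁ : a * x + b * y ≡ a * 1 + b * 1 [MOD a + b + c] :=
    (hx.mul_left a).add (hy.mul_left b)
  have h₂ : a * 1 + b * 1 ≡ c * 1 [MOD a + b + c] :=
    h₁.symm.trans (h ▸ hz.mul_left c)
  exact habc (by simpa using h₂.eq_of_lt_of_lt (by omega) (by omega))

/-- The values of a new element that could complete a solution to `ax + by = cz` together with
elements of `B`, at least one of them in `A`, along with the elements of `B` themselves. -/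
def forbidden (a b c : ℕ) (A B : Finset ℕ) : Finset ℕ :=
  B ∪ ((A ×ˢ B).image (fun p => (a * p.1 + b * p.2) / c) ∪
    (A ×ˢ B).image (fun p => (a * p.2 + b * p.1) / c) ∪
    (A ×ˢ B).image (fun p => (c * p.1 - b * p.2) / a) ∪
    (A ×ˢ B).image (fun p => (c * p.2 - b * p.1) / a) ∪
    (A ×ˢ B).image (fun p => (c * p.1 - a * p.2) / b) ∪
    (A ×ˢ B).image (fun p => (c * p.2 - a * p.1) / b)) ∪
    (A.image (fun u => c * u / (a + b)) ∪ A.image (fun u => b * u / (c - a)) ∪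
    A.image (fun u => a * u / (c - b)))

theorem card_forbidden_le (a b c : ℕ) (A B : Finset ℕ) :
    (forbidden a b c A B).card ≤ B.card + 6 * (A.card * B.card) + 3 * A.card := by
  have hp : ∀ f : ℕ × ℕ → ℕ, ((A ×ˢ B).image f).card ≤ A.card * B.card := fun f =>
    Finset.card_image_le.trans (Finset.card_product A B).le
  have hs : ∀ f : ℕ → ℕ, (A.image f).card ≤ A.card := fun f => Finset.card_image_le
  unfold forbidden
  refine (Finset.card_union_le _ _).trans (add_le_add ((Finset.card_union_le _ _).trans
    (add_le_add le_rfl ?_)) ?_)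
  · have h : ∀ {S T : Finset ℕ} {m n : ℕ}, S.card ≤ m → T.card ≤ n → (S ∪ T).card ≤ m + n :=
      fun h₁ h₂ => (Finset.card_union_le _ _).trans (add_le_add h₁ h₂)
    exact (h (h (h (h (h (hp _) (hp _)) (hp _)) (hp _)) (hp _)) (hp _)).trans (by omega)
  · exact (Finset.card_union_le _ _).trans ((add_le_add ((Finset.card_union_le _ _).trans
      (add_le_add (hs _) (hs _))) (hs _)).trans (by omega))

/-- Adjoining to `B` an element congruent to `1` that is not forbidden creates no solution. -/
theorem mem_of_notMem_forbidden {a b c w : ℕ} {A B : Finset ℕ} (ha : 0 < a) (hb : 0 < b)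
    (hc : 0 < c) (habc : a + b ≠ c) (hA : ∀ x ∈ A, 0 < x)
    (hmod : ∀ x ∈ B, x ∈ A ∨ x ≡ 1 [MOD a + b + c])
    (hsol : ∀ x ∈ B, ∀ y ∈ B, ∀ z ∈ B, a * x + b * y = c * z → x ∈ A ∧ y ∈ A ∧ z ∈ A)
    (hw : w ≡ 1 [MOD a + b + c]) (hwF : w ∉ forbidden a b c A B) :
    ∀ x ∈ insert w B, ∀ y ∈ insert w B, ∀ z ∈ insert w B,
      a * x + b * y = c * z → x ∈ A ∧ y ∈ A ∧ z ∈ A := by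
  simp only [forbidden, Finset.mem_union, Finset.mem_image, Finset.mem_product, Prod.exists,
    not_or, not_exists, not_and, and_imp] at hwF
  obtain ⟨⟨-, ⟨⟨⟨⟨h₁, h₂⟩, h₃⟩, h₄⟩, h₅⟩, h₆⟩, ⟨h₇, h₈⟩, h₉⟩ := hwF
  have hdiv : ∀ {d m : ℕ}, 0 < d → d * w = m → m / d = w := fun hd h =>
    Nat.div_eq_of_eq_mul_right hd h.symm
  intro x hx y hy z hz h
  rw [Finset.mem_insert] at hx hy hz
  rcases hx with rfl | hx <;> rcases hy with rfl | hy <;> rcases hz with rfl | hz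
  · exact absurd h (ne_of_modEq_one ha hc habc hw hw hw)
  · rcases hmod z hz with hzA | hz'
    · exact absurd (hdiv (by omega) (by linarith)) (h₇ z hzA)
    · exact absurd h (ne_of_modEq_one ha hc habc hw hw hz')
  · rcases hmod y hy with hyA | hy'
    · have hpos : 0 < b * y := Nat.mul_pos hb (hA y hyA)
      have hac : a < c := by
        by_contra! hle
        have := Nat.mul_le_mul_right z hle
        omega
      refine absurd (hdiv (by omega) ?_) (h₈ y hyA)
      rw [Nat.sub_mul]; omega
    · exact absurd h (ne_of_modEq_one ha hc habc hw hy' hw)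
  · rcases hmod y hy with hyA | hy'
    · exact absurd (hdiv ha (by omega)) (h₄ y z hyA hz)
    · rcases hmod z hz with hzA | hz'
      · exact absurd (hdiv ha (by omega)) (h₃ z y hzA hy)
      · exact absurd h (ne_of_modEq_one ha hc habc hw hy' hz')
  · rcases hmod x hx with hxA | hx'
    · have hpos : 0 < a * x := Nat.mul_pos ha (hA x hxA)
      have hbc : b < c := by
        by_contra! hle
        have := Nat.mul_le_mul_right z hle
        omega
      refine absurd (hdiv (by omega) ?_) (h₉ x hxA)
      rw [Nat.sub_mul]; omega
    · exact absurd h (ne_of_modEq_one ha hc habc hx' hw hw)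
  · rcases hmod x hx with hxA | hx'
    · exact absurd (hdiv hb (by omega)) (h₆ x z hxA hz)
    · rcases hmod z hz with hzA | hz'
      · exact absurd (hdiv hb (by omega)) (h₅ z x hzA hx)
      · exact absurd h (ne_of_modEq_one ha hc habc hx' hw hz')
  · rcases hmod x hx with hxA | hx'
    · exact absurd (hdiv hc (by omega)) (h₁ x y hxA hy)
    · rcases hmod y hy with hyA | hy'
      · exact absurd (hdiv hc (by omega)) (h₂ y x hyA hx)
      · exact absurd h (ne_of_modEq_one ha hc habc hx' hy' hw)
  · exact hsol x hx y hy z hz h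

/-- Some element of the progression `1 + qℕ` up to `1 + q|F|` avoids the finite set `F`. -/
theorem exists_modEq_one_notMem {q : ℕ} (hq : 0 < q) (F : Finset ℕ) :
    ∃ w, 0 < w ∧ w ≡ 1 [MOD q] ∧ w ∉ F ∧ w ≤ 1 + q * F.card := by
  have hinj : Function.Injective (fun j : ℕ => 1 + q * j) := fun i j h =>
    Nat.eq_of_mul_eq_mul_left hq (Nat.add_left_cancel h)
  have hcard : F.card < ((Finset.range (F.card + 1)).image (fun j => 1 + q * j)).card := by
    rw [Finset.card_image_of_injective _ hinj, Finset.card_range]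
    exact Nat.lt_succ_self _
  obtain ⟨w, hw, hwF⟩ := Finset.exists_mem_notMem_of_card_lt_card hcard
  obtain ⟨j, hj, rfl⟩ := Finset.mem_image.1 hw
  refine ⟨_, by omega, by simp [Nat.ModEq], hwF, ?_⟩
  exact Nat.add_le_add_left (Nat.mul_le_mul_left q (by simpa [Nat.lt_succ_iff] using hj)) 1

/-- Greedy extension of `A` by `k` elements congruent to `1` without new solutions. -/
theorem exists_extension {a b c M : ℕ} {A : Finset ℕ} (ha : 0 < a) (hb : 0 < b) (hc : 0 < c)
    (habc : a + b ≠ c) (hne : A.Nonempty) (hA : ∀ x ∈ A, 0 < x) (hM : ∀ x ∈ A, x ≤ M) (k : ℕ) :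
    ∃ B : Finset ℕ, A ⊆ B ∧ B.card = A.card + k ∧
      (∀ x ∈ B, x ∈ A ∨ x ≡ 1 [MOD a + b + c]) ∧
      (∀ x ∈ B, ∀ y ∈ B, ∀ z ∈ B, a * x + b * y = c * z → x ∈ A ∧ y ∈ A ∧ z ∈ A) ∧
      (∀ x ∈ B, 0 < x) ∧ ∀ x ∈ B, x ≤ 11 * (a + b + c) * (A.card + k) * M := by
  have hn : 0 < A.card := hne.card_pos
  have hnM : A.card ≤ M := by
    have hsub : A ⊆ Finset.Icc 1 M := fun x hx => Finset.mem_Icc.2 ⟨hA x hx, hM x hx⟩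
    simpa using Finset.card_le_card hsub
  induction k with
  | zero =>
    refine ⟨A, subset_rfl, rfl, fun x hx => Or.inl hx, fun x hx y hy z hz _ => ⟨hx, hy, hz⟩, hA,
      fun x hx => (hM x hx).trans (Nat.le_mul_of_pos_left M ?_)⟩
    have hq : 0 < a + b + c := by omega
    positivity
  | succ k ih =>
    obtain ⟨B, hAB, hcard, hmod, hsol, hpos, hbound⟩ := ih
    obtain ⟨w, hw0, hw, hwF, hwle⟩ :=
      exists_modEq_one_notMem (q := a + b + c) (by omega) (forbidden a b c A B)
    have hwB : w ∉ B := fun h => hwF (by simp [forbidden, h])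
    refine ⟨insert w B, hAB.trans (Finset.subset_insert w B), ?_, ?_,
      mem_of_notMem_forbidden ha hb hc habc hA hmod hsol hw hwF, ?_, ?_⟩
    · rw [Finset.card_insert_of_notMem hwB, hcard, add_assoc]
    · exact (Finset.forall_mem_insert _ _ _).2 ⟨Or.inr hw, hmod⟩
    · exact (Finset.forall_mem_insert _ _ _).2 ⟨hw0, hpos⟩
    · have hmono : 11 * (a + b + c) * (A.card + k) * M ≤
          11 * (a + b + c) * (A.card + (k + 1)) * M := by gcongr; omega
      refine (Finset.forall_mem_insert _ _ _).2 ⟨le_trans ?_ hmono,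
        fun x hx => (hbound x hx).trans hmono⟩
      have hF := card_forbidden_le a b c A B
      rw [hcard] at hF
      have h₁ : A.card + k ≤ (A.card + k) * M := Nat.le_mul_of_pos_right _ (hn.trans_le hnM)
      have h₂ : A.card * (A.card + k) ≤ (A.card + k) * M := by
        rw [mul_comm]; exact Nat.mul_le_mul_left _ hnM
      have h₃ : (forbidden a b c A B).card ≤ 10 * ((A.card + k) * M) := by omega
      have h₄ : 1 ≤ (a + b + c) * ((A.card + k) * M) :=
        Nat.mul_pos (by omega) (by omega)
      have h₅ := Nat.mul_le_mul_left (a + b + c) h₃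
      linarith

/-- For `a + b ≠ c` there is a constant `K = K(a,b,c)` such that every
nonempty finite set `A` of positive integers can, for any `t > |A|`, be extended to a set
`B ⊇ A` of positive integers with `|B| = t`, all solutions to `ax + by = cz` in `B` lying
in `A`, and `max(B) ≤ K·t·(max A)²`. -/
theorem stmt_12 (a b c : ℕ) (ha : 0 < a) (hb : 0 < b) (hc : 0 < c)
    (habc : a + b ≠ c) :
    ∃ K : ℕ, ∀ (A : Finset ℕ) (hA : A.Nonempty), (∀ x ∈ A, 0 < x) →
      ∀ t : ℕ, A.card < t →
        ∃ B : Finset ℕ, (∀ x ∈ B, 0 < x) ∧ B.card = t ∧ A ⊆ B ∧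
          (∀ x ∈ B, ∀ y ∈ B, ∀ z ∈ B, a * x + b * y = c * z →
            x ∈ A ∧ y ∈ A ∧ z ∈ A) ∧
          ∀ hB : B.Nonempty, B.max' hB ≤ K * t * (A.max' hA) ^ 2 := by
  refine ⟨11 * (a + b + c), fun A hA hpos t ht => ?_⟩
  obtain ⟨B, hAB, hcard, -, hsol, hBpos, hbound⟩ :=
    exists_extension (M := A.max' hA) ha hb hc habc hA hpos
      (fun x hx => A.le_max' x hx) (t - A.card)
  rw [Nat.add_sub_cancel' ht.le] at hcard hbound
  exact ⟨B, hBpos, hcard, hAB, hsol, fun hB => (hbound _ (B.max'_mem hB)).trans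
    (Nat.mul_le_mul_left _ (Nat.le_self_pow two_ne_zero _))⟩
end

section
/- Let a, b, c be fixed positive integers with a + b = c. Then for every nonempty finite set A of positive integers and every positive integer t, there exists a finite set B of positive integers such that (i) |B| = |A| + t; (ii) A ⊆ B; (iii) every non-trivial solution (x, y, z) ∈ B³ to ax + by = cz (i.e. with x, y, z not all equal) satisfies x, y, z ∈ A; and (iv) max(B) = 2·max(A)·c^t. In fact one may take B = A ∪ {c^i·2·max(A) : i ∈ {1,…,t}}. -/
/-- If `B` consists of positive integers, every element of `B` outside `A` is at least `c` times
each smaller element of `B`, and `A` is an initial segment of `B`, then the solutions of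
`a * x + b * y = c * z` in `B` with `y < x` lie in `A`. -/
theorem mem_of_lt_of_linear_eq {a b c : ℕ} (ha : 0 < a) (hb : 0 < b) (habc : a + b = c)
    {A B : Finset ℕ} (hpos : ∀ x ∈ B, 0 < x)
    (hgap : ∀ w ∈ B, w ∉ A → ∀ z ∈ B, z < w → c * z ≤ w)
    (hinit : ∀ w ∈ A, ∀ z ∈ B, z < w → z ∈ A)
    {x y z : ℕ} (hx : x ∈ B) (hy : y ∈ B) (hz : z ∈ B)
    (h : a * x + b * y = c * z) (hxy : y < x) : x ∈ A ∧ y ∈ A ∧ z ∈ A := by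
  have hzx : z < x := by
    subst habc
    by_contra! hle
    nlinarith [Nat.mul_le_mul_left (a + b) hle, Nat.mul_lt_mul_of_pos_left hxy hb]
  have hxA : x ∈ A := by
    by_contra hxA
    have hcz := hgap x hx hxA z hz hzx
    nlinarith [Nat.mul_pos hb (hpos y hy), Nat.mul_le_mul_right x ha]
  exact ⟨hxA, hinit x hxA y hy hxy, hinit x hxA z hz hzx⟩


/-- For `a + b = c`, every nonempty finite set `A` of positive integers and
every `t > 0` admit an extension `B ⊇ A` of positive integers with `|B| = |A| + t`, all
non-trivial solutions to `ax + by = cz` in `B` lying in `A`, and `max(B) = 2·max(A)·c^t`;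
in fact one may take `B = A ∪ {cⁱ·2·max(A) : i ∈ {1,…,t}}`. -/
theorem stmt_13 (a b c : ℕ) (ha : 0 < a) (hb : 0 < b) (hc : 0 < c)
    (habc : a + b = c)
    (A : Finset ℕ) (hA : A.Nonempty) (hApos : ∀ x ∈ A, 0 < x)
    (t : ℕ) (ht : 0 < t) :
    ∃ B : Finset ℕ,
      B = A ∪ (Finset.Icc 1 t).image (fun i => c ^ i * (2 * A.max' hA)) ∧
      (∀ x ∈ B, 0 < x) ∧ B.card = A.card + t ∧ A ⊆ B ∧
      (∀ x ∈ B, ∀ y ∈ B, ∀ z ∈ B, a * x + b * y = c * z → ¬ (x = y ∧ y = z) →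
        x ∈ A ∧ y ∈ A ∧ z ∈ A) ∧
      ∀ hB : B.Nonempty, B.max' hB = 2 * A.max' hA * c ^ t := by
  have hc2 : 1 < c := by omega
  set M := A.max' hA with hM
  have hMpos : 0 < M := hApos _ (A.max'_mem hA)
  have hle : ∀ x ∈ A, x ≤ M := fun x hx => A.le_max' x hx
  have hbig : ∀ i, 2 * M ≤ c ^ i * (2 * M) := fun i =>
    Nat.le_mul_of_pos_left _ (pow_pos hc i)
  have hmem : ∀ x, x ∈ A ∪ (Finset.Icc 1 t).image (fun i => c ^ i * (2 * M)) ↔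
      x ∈ A ∨ ∃ i, (1 ≤ i ∧ i ≤ t) ∧ c ^ i * (2 * M) = x := by
    simp
  have hpos : ∀ x ∈ A ∪ (Finset.Icc 1 t).image (fun i => c ^ i * (2 * M)), 0 < x := by
    intro x hx
    rcases (hmem x).1 hx with hx | ⟨i, -, rfl⟩
    · exact hApos x hx
    · positivity
  have hgap : ∀ w ∈ A ∪ (Finset.Icc 1 t).image (fun i => c ^ i * (2 * M)), w ∉ A →
      ∀ z ∈ A ∪ (Finset.Icc 1 t).image (fun i => c ^ i * (2 * M)), z < w → c * z ≤ w := by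
    intro w hw hwA z hz hzw
    rcases (hmem w).1 hw with hw | ⟨i, ⟨hi, -⟩, rfl⟩
    · exact absurd hw hwA
    rcases (hmem z).1 hz with hz | ⟨j, -, rfl⟩
    · have hci : c ≤ c ^ i := Nat.le_self_pow (by omega) c
      exact Nat.mul_le_mul hci (by have := hle z hz; omega)
    · have hji : j < i :=
        (Nat.pow_lt_pow_iff_right hc2).1 (Nat.lt_of_mul_lt_mul_right hzw)
      rw [← mul_assoc, ← pow_succ']
      exact Nat.mul_le_mul_right _ (Nat.pow_le_pow_right hc hji)
  have hinit : ∀ w ∈ A, ∀ z ∈ A ∪ (Finset.Icc 1 t).image (fun i => c ^ i * (2 * M)),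
      z < w → z ∈ A := by
    intro w hw z hz hzw
    rcases (hmem z).1 hz with hz | ⟨j, -, rfl⟩
    · exact hz
    · have := hle w hw
      have := hbig j
      omega
  refine ⟨_, rfl, hpos, ?_, Finset.subset_union_left, ?_, ?_⟩
  · rw [Finset.card_union_of_disjoint, Finset.card_image_of_injective, Nat.card_Icc,
      Nat.add_sub_cancel]
    · intro i j hij
      exact Nat.pow_right_injective hc2 (Nat.eq_of_mul_eq_mul_right (by omega) hij)
    · rw [Finset.disjoint_right]
      intro x hx hxA
      obtain ⟨i, -, rfl⟩ := Finset.mem_image.1 hx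
      have := hle _ hxA
      have := hbig i
      omega
  · intro x hx y hy z hz h hne
    rcases lt_trichotomy x y with hxy | rfl | hxy
    · have := mem_of_lt_of_linear_eq hb ha (by omega) hpos hgap hinit hy hx hz
        (by omega) hxy
      exact ⟨this.2.1, this.1, this.2.2⟩
    · rw [← add_mul, habc] at h
      exact absurd ⟨rfl, Nat.eq_of_mul_eq_mul_left hc h⟩ hne
    · exact mem_of_lt_of_linear_eq ha hb habc hpos hgap hinit hx hy hz h hxy
  · intro hB
    rw [mul_comm (2 * M)]
    refine le_antisymm (Finset.max'_le _ _ _ fun x hx => ?_)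
      (Finset.le_max' _ _ ((hmem _).2 (Or.inr ⟨t, ⟨ht, le_rfl⟩, rfl⟩)))
    rcases (hmem x).1 hx with hx | ⟨i, ⟨-, hi⟩, rfl⟩
    · have := hle x hx
      have := hbig t
      omega
    · exact Nat.mul_le_mul_right _ (Nat.pow_le_pow_right hc hi)
end

section
/- Fix positive integers a₁, a₂, b with a₁ + a₂ ≠ b, and the equation L: a₁x + a₂y = bz. Let A ⊆ ℤ be finite and B ⊆ A be such that B is L-free and B ∪ {u} is L-free for every u ∈ A∖B. Then there exists C ⊆ A∖B with |C| ≥ (|A| − |B|)/(6|B| + 1) such that every bad triple with all three entries in B ∪ C in fact has all three entries in C. -/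
/-- For `a₁ + a₂ ≠ b` every solution is non-trivial, so a finite set `S ⊆ ℤ` is L-free for
`a₁x + a₂y = bz` if it contains no solution at all (repetitions allowed). -/
def SolFree (a₁ a₂ b : ℕ) (S : Finset ℤ) : Prop :=
  ¬ ∃ x ∈ S, ∃ y ∈ S, ∃ z ∈ S, (a₁ : ℤ) * x + (a₂ : ℤ) * y = (b : ℤ) * z

/-- A relation of degree at most `d` on `V` has an independent subset of `V` of size at least
`|V| / (d + 1)`. -/
theorem exists_independent_of_degree_le {α : Type*} [DecidableEq α] (V : Finset α)
    (R : α → α → Prop) (hR : ∀ u v, R u v → R v u) (d : ℕ) (N : α → Finset α)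
    (hN : ∀ u v, R u v → v ∈ N u) (hd : ∀ u, (N u).card ≤ d) :
    ∃ C ⊆ V, (∀ u ∈ C, ∀ v ∈ C, u ≠ v → ¬ R u v) ∧ V.card ≤ C.card * (d + 1) := by
  classical
  let F := V.powerset.filter fun C => ∀ u ∈ C, ∀ v ∈ C, u ≠ v → ¬ R u v
  obtain ⟨C, hCF, hmax⟩ := F.exists_max_image Finset.card ⟨∅, by simp [F]⟩
  simp only [F, Finset.mem_filter, Finset.mem_powerset] at hCF hmax
  obtain ⟨hCV, hind⟩ := hCF
  refine ⟨C, hCV, hind, ?_⟩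
  have hcover : V ⊆ C.biUnion fun c => insert c (N c) := by
    intro v hv
    by_contra h
    simp only [Finset.mem_biUnion, Finset.mem_insert, not_exists, not_and, not_or] at h
    have hvC : v ∉ C := fun hvC => (h v hvC).1 rfl
    have hnot : ∀ c ∈ C, ¬ R c v := fun c hc hcv => (h c hc).2 (hN c v hcv)
    have hle := hmax (insert v C) ⟨Finset.insert_subset hv hCV, by
      intro x hx y hy hxy hr
      rcases Finset.mem_insert.1 hx with hxv | hx <;> rcases Finset.mem_insert.1 hy with hyv | hy
      · exact hxy (hxv.trans hyv.symm)
      · exact hnot y hy (hR _ _ (hxv ▸ hr))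
      · exact hnot x hx (hyv ▸ hr)
      · exact hind x hx y hy hxy hr⟩
    rw [Finset.card_insert_of_notMem hvC] at hle
    omega
  exact (Finset.card_le_card hcover).trans <| Finset.card_biUnion_le_card_mul _ _ _ fun c _ =>
    (Finset.card_insert_le _ _).trans (Nat.add_le_add_right (hd c) 1)

/-- The integers `v` that can be completed to a solution of `a₁x + a₂y = bz` whose other two entries
are `u` and `w`, in some order. -/
def solCompletions (a₁ a₂ b : ℕ) (u w : ℤ) : Finset ℤ :=
  {(a₁ * w + a₂ * u) / b, (b * u - a₁ * w) / a₂, (a₁ * u + a₂ * w) / b,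
    (b * u - a₂ * w) / a₁, (b * w - a₁ * u) / a₂, (b * w - a₂ * u) / a₁}

/-- `u`, `v` and `w` form, in some order, a solution of `a₁x + a₂y = bz`. -/
def FormSol (a₁ a₂ b : ℕ) (u v w : ℤ) : Prop :=
  (a₁ * w + a₂ * u = b * v ∨ a₁ * w + a₂ * v = b * u) ∨
    (a₁ * u + a₂ * w = b * v ∨ a₁ * v + a₂ * w = b * u) ∨
    (a₁ * u + a₂ * v = b * w ∨ a₁ * v + a₂ * u = b * w)

theorem FormSol.symm {a₁ a₂ b : ℕ} {u v w : ℤ} (h : FormSol a₁ a₂ b u v w) :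
    FormSol a₁ a₂ b v u w := by
  unfold FormSol at *
  tauto

theorem FormSol.mem_solCompletions {a₁ a₂ b : ℕ} (h₁ : 0 < a₁) (h₂ : 0 < a₂) (hb : 0 < b)
    {u v w : ℤ} (h : FormSol a₁ a₂ b u v w) : v ∈ solCompletions a₁ a₂ b u w := by
  have key : ∀ {c : ℕ} {t : ℤ}, 0 < c → c * v = t → v = t / c := fun hc ht =>
    (Int.ediv_eq_of_eq_mul_right (by exact_mod_cast hc.ne') ht.symm).symm
  simp only [solCompletions, Finset.mem_insert, Finset.mem_singleton]
  rcases h with (h | h) | (h | h) | (h | h)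
  · exact .inl (key hb (by linarith))
  · exact .inr (.inl (key h₂ (by linarith)))
  · exact .inr (.inr (.inl (key hb (by linarith))))
  · exact .inr (.inr (.inr (.inl (key h₁ (by linarith)))))
  · exact .inr (.inr (.inr (.inr (.inl (key h₂ (by linarith))))))
  · exact .inr (.inr (.inr (.inr (.inr (key h₁ (by linarith))))))

/-- If `B ⊆ A` is L-free and `B ∪ {u}` is L-free for every `u ∈ A∖B`, then
there is `C ⊆ A∖B` with `|C| ≥ (|A| − |B|)/(6|B| + 1)` such that every bad triple with all
entries in `B ∪ C` has all entries in `C`. -/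
theorem stmt_17 (a₁ a₂ b : ℕ) (h₁ : 0 < a₁) (h₂ : 0 < a₂) (hb : 0 < b)
    (hne : a₁ + a₂ ≠ b) (A B : Finset ℤ) (hBA : B ⊆ A)
    (hBfree : SolFree a₁ a₂ b B)
    (hext : ∀ u ∈ A \ B, SolFree a₁ a₂ b (insert u B)) :
    ∃ C ⊆ A \ B,
      ((A.card : ℝ) - (B.card : ℝ)) / (6 * (B.card : ℝ) + 1) ≤ (C.card : ℝ) ∧
      ∀ x ∈ B ∪ C, ∀ y ∈ B ∪ C, ∀ z ∈ B ∪ C,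
        (a₁ : ℤ) * x + (a₂ : ℤ) * y = (b : ℤ) * z → x ∈ C ∧ y ∈ C ∧ z ∈ C := by
  obtain ⟨C, hCV, hind, hcard⟩ := exists_independent_of_degree_le (A \ B)
    (fun u v => ∃ w ∈ B, FormSol a₁ a₂ b u v w)
    (fun u v ⟨w, hw, h⟩ => ⟨w, hw, h.symm⟩) (B.card * 6)
    (fun u => B.biUnion (solCompletions a₁ a₂ b u))
    (fun u v ⟨w, hw, h⟩ => Finset.mem_biUnion.2 ⟨w, hw, h.mem_solCompletions h₁ h₂ hb⟩)
    (fun u => Finset.card_biUnion_le_card_mul _ _ _ fun w _ => Finset.card_le_six)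
  refine ⟨C, hCV, ?_, ?_⟩
  · rw [div_le_iff₀ (by positivity)]
    have h := Finset.card_sdiff_add_card_eq_card hBA
    have hc : (A.card : ℝ) ≤ C.card * (B.card * 6 + 1) + B.card := by
      exact_mod_cast (by omega : A.card ≤ C.card * (B.card * 6 + 1) + B.card)
    linarith
  · have hfree : ∀ u ∈ C, ∀ x ∈ insert u B, ∀ y ∈ insert u B, ∀ z ∈ insert u B,
        ¬ (a₁ : ℤ) * x + (a₂ : ℤ) * y = (b : ℤ) * z :=
      fun u hu x hx y hy z hz h => hext u (hCV hu) ⟨x, hx, y, hy, z, hz, h⟩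
    have hpair : ∀ u ∈ C, ∀ v ∈ C, ∀ w ∈ B, ¬ FormSol a₁ a₂ b u v w := by
      intro u hu v hv w hw h
      by_cases huv : u = v
      · subst huv
        have hu' := Finset.mem_insert_self u B
        have hw' := Finset.mem_insert_of_mem (a := w) (b := u) hw
        rcases h with (h | h) | (h | h) | (h | h)
        · exact hfree u hu w hw' u hu' u hu' h
        · exact hfree u hu w hw' u hu' u hu' h
        · exact hfree u hu u hu' w hw' u hu' h
        · exact hfree u hu u hu' w hw' u hu' h
        · exact hfree u hu u hu' u hu' w hw' h
        · exact hfree u hu u hu' u hu' w hw' h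
      · exact hind u hu v hv huv ⟨w, hw, h⟩
    intro x hx y hy z hz h
    rcases Finset.mem_union.1 hx with hx | hx <;> rcases Finset.mem_union.1 hy with hy | hy <;>
      rcases Finset.mem_union.1 hz with hz | hz
    · exact (hBfree ⟨x, hx, y, hy, z, hz, h⟩).elim
    · exact (hfree z hz x (by simp [hx]) y (by simp [hy]) z (by simp) h).elim
    · exact (hfree y hy x (by simp [hx]) y (by simp) z (by simp [hz]) h).elim
    · exact (hpair y hy z hz x hx (.inl (.inl h))).elim
    · exact (hfree x hx x (by simp) y (by simp [hy]) z (by simp [hz]) h).elim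
    · exact (hpair x hx z hz y hy (.inr (.inl (.inl h)))).elim
    · exact (hpair x hx y hy z hz (.inr (.inr (.inl h)))).elim
    · exact ⟨hx, hy, hz⟩
end

section
/- Fix positive integers a₁, a₂, b with a₁ + a₂ ≠ b, and the equation L: a₁x + a₂y = bz. Let λ > 0 be such that every finite set Z ⊆ ℤ∖{0} contains an L-free subset of size at least λ|Z|. Let A ⊆ ℤ∖{0} be finite, let B ⊆ A be such that B is L-free and B ∪ {u} is L-free for every u ∈ A∖B, and let k ∈ ℕ satisfy |B| ≤ k and |A| ≥ ((6|B| + 1)/λ)·(k − |B|) + |B|. Then A contains an L-free subset of cardinality exactly k which contains B. -/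
/-- Greedy independent set: if the neighbours of every `u` under a symmetric relation lie in a set
of size at most `d`, then `m * (d + 1)` points contain `m` pairwise unrelated ones. -/
theorem exists_card_eq_pairwise_not {α : Type*} [DecidableEq α] (R : α → α → Prop)
    (hR : ∀ u v, R u v → R v u) (N : α → Finset α) (hN : ∀ u v, R u v → v ∈ N u) (d : ℕ)
    (hd : ∀ u, (N u).card ≤ d) (m : ℕ) (S : Finset α) (hS : m * (d + 1) ≤ S.card) :
    ∃ I ⊆ S, I.card = m ∧ ∀ u ∈ I, ∀ v ∈ I, u ≠ v → ¬ R u v := by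
  induction m generalizing S with
  | zero => exact ⟨∅, by simp, by simp, by simp⟩
  | succ m ih =>
    have hpos : 0 < S.card := by nlinarith
    obtain ⟨u, hu⟩ := Finset.card_pos.mp hpos
    have hcard : m * (d + 1) ≤ (S \ insert u (N u)).card := by
      have h1 := Finset.le_card_sdiff (insert u (N u)) S
      have h2 := Finset.card_insert_le u (N u)
      have h3 := hd u
      rw [Nat.succ_mul] at hS
      omega
    obtain ⟨I, hI, hIm, hIR⟩ := ih _ hcard
    have hIu : ∀ v ∈ I, v ≠ u ∧ ¬ R u v := by
      intro v hv
      have h := hI hv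
      simp only [Finset.mem_sdiff, Finset.mem_insert, not_or] at h
      exact ⟨h.2.1, fun h' => h.2.2 (hN _ _ h')⟩
    refine ⟨insert u I, ?_, ?_, ?_⟩
    · exact Finset.insert_subset hu (hI.trans Finset.sdiff_subset)
    · rw [Finset.card_insert_of_notMem (fun h => (hIu u h).1 rfl), hIm]
    · intro x hx y hy hxy
      rcases Finset.mem_insert.mp hx with rfl | hxI <;>
        rcases Finset.mem_insert.mp hy with rfl | hyI
      · exact absurd rfl hxy
      · exact (hIu y hyI).2
      · exact fun h => (hIu x hxI).2 (hR _ _ h)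
      · exact hIR x hxI y hyI hxy

/-- `u` and `v` solve the equation together with one element of `B`, with `u` to the left of `v`. -/
def OrderedConflict (a₁ a₂ b : ℕ) (B : Finset ℤ) (u v : ℤ) : Prop :=
  ∃ w ∈ B, (a₁ : ℤ) * u + a₂ * v = b * w ∨ (a₁ : ℤ) * u + a₂ * w = b * v ∨
    (a₁ : ℤ) * w + a₂ * u = b * v

/-- A finite set containing every `v` that conflicts with `u`, in either order. -/
def conflictCandidates (a₁ a₂ b : ℕ) (B : Finset ℤ) (u : ℤ) : Finset ℤ :=
  B.biUnion fun w =>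
    {(b * w - a₁ * u) / a₂, (a₁ * u + a₂ * w) / b, (a₁ * w + a₂ * u) / b,
      (b * w - a₂ * u) / a₁, (b * u - a₂ * w) / a₁, (b * u - a₁ * w) / a₂}

theorem card_conflictCandidates_le (a₁ a₂ b : ℕ) (B : Finset ℤ) (u : ℤ) :
    (conflictCandidates a₁ a₂ b B u).card ≤ 6 * B.card := by
  rw [mul_comm]
  exact Finset.card_biUnion_le_card_mul _ _ _ fun w _ => Finset.card_le_six

theorem mem_conflictCandidates {a₁ a₂ b : ℕ} (h₁ : 0 < a₁) (h₂ : 0 < a₂) (hb : 0 < b)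
    {B : Finset ℤ} {u v : ℤ}
    (h : OrderedConflict a₁ a₂ b B u v ∨ OrderedConflict a₁ a₂ b B v u) :
    v ∈ conflictCandidates a₁ a₂ b B u := by
  have key : ∀ {c : ℕ} {n : ℤ}, 0 < c → (c : ℤ) * v = n → v = n / c := by
    intro c n hc hn
    rw [← hn, Int.mul_ediv_cancel_left]
    exact_mod_cast hc.ne'
  simp only [conflictCandidates, Finset.mem_biUnion, Finset.mem_insert, Finset.mem_singleton]
  rcases h with ⟨w, hw, h | h | h⟩ | ⟨w, hw, h | h | h⟩ <;> refine ⟨w, hw, ?_⟩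
  · exact Or.inl (key h₂ (by linarith))
  · exact Or.inr (Or.inl (key hb (by linarith)))
  · exact Or.inr (Or.inr (Or.inl (key hb (by linarith))))
  · exact Or.inr (Or.inr (Or.inr (Or.inl (key h₁ (by linarith)))))
  · exact Or.inr (Or.inr (Or.inr (Or.inr (Or.inl (key h₁ (by linarith))))))
  · exact Or.inr (Or.inr (Or.inr (Or.inr (Or.inr (key h₂ (by linarith))))))

theorem SolFree.union {a₁ a₂ b : ℕ} {B I : Finset ℤ} (hB : SolFree a₁ a₂ b B)
    (hI : SolFree a₁ a₂ b I) (hext : ∀ u ∈ I, SolFree a₁ a₂ b (insert u B))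
    (hconf : ∀ u ∈ I, ∀ v ∈ I, u ≠ v → ¬ OrderedConflict a₁ a₂ b B u v) :
    SolFree a₁ a₂ b (B ∪ I) := by
  have ext : ∀ u ∈ I, ∀ x ∈ insert u B, ∀ y ∈ insert u B, ∀ z ∈ insert u B,
      (a₁ : ℤ) * x + a₂ * y ≠ b * z :=
    fun u hu x hx y hy z hz h => hext u hu ⟨x, hx, y, hy, z, hz, h⟩
  have pair : ∀ u ∈ I, ∀ v ∈ I, OrderedConflict a₁ a₂ b B u v → u = v :=
    fun u hu v hv h => by_contra fun huv => hconf u hu v hv huv h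
  rintro ⟨x, hx, y, hy, z, hz, h⟩
  rcases Finset.mem_union.mp hx with hx | hx <;> rcases Finset.mem_union.mp hy with hy | hy <;>
    rcases Finset.mem_union.mp hz with hz | hz
  · exact hB ⟨x, hx, y, hy, z, hz, h⟩
  · exact ext z hz x (by simp [hx]) y (by simp [hy]) z (by simp) h
  · exact ext y hy x (by simp [hx]) y (by simp) z (by simp [hz]) h
  · obtain rfl := pair y hy z hz ⟨x, hx, Or.inr (Or.inr h)⟩
    exact ext y hy x (by simp [hx]) y (by simp) y (by simp) h
  · exact ext x hx x (by simp) y (by simp [hy]) z (by simp [hz]) h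
  · obtain rfl := pair x hx z hz ⟨y, hy, Or.inr (Or.inl h)⟩
    exact ext x hx x (by simp) y (by simp [hy]) x (by simp) h
  · obtain rfl := pair x hx y hy ⟨z, hz, Or.inl h⟩
    exact ext x hx x (by simp) x (by simp) z (by simp [hz]) h
  · exact hI ⟨x, hx, y, hy, z, hz, h⟩

/-- Suppose every finite set of nonzero integers `Z` contains an L-free
subset of size at least `λ|Z|`. If `A ⊆ ℤ∖{0}` is finite, `B ⊆ A` is L-free with `B ∪ {u}`
L-free for all `u ∈ A∖B`, and `|B| ≤ k` with `|A| ≥ ((6|B|+1)/λ)(k − |B|) + |B|`, then `A`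
has an L-free subset of cardinality exactly `k` containing `B`. -/
theorem stmt_18 (a₁ a₂ b : ℕ) (h₁ : 0 < a₁) (h₂ : 0 < a₂) (hb : 0 < b)
    (hne : a₁ + a₂ ≠ b) (lam : ℝ) (hlam : 0 < lam)
    (hlamprop : ∀ Z : Finset ℤ, (∀ z ∈ Z, z ≠ 0) →
      ∃ S ⊆ Z, SolFree a₁ a₂ b S ∧ lam * (Z.card : ℝ) ≤ (S.card : ℝ))
    (A B : Finset ℤ) (hA0 : ∀ z ∈ A, z ≠ 0) (hBA : B ⊆ A)
    (hBfree : SolFree a₁ a₂ b B)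
    (hext : ∀ u ∈ A \ B, SolFree a₁ a₂ b (insert u B))
    (k : ℕ) (hk : B.card ≤ k)
    (hsize : ((6 * (B.card : ℝ) + 1) / lam) * ((k : ℝ) - (B.card : ℝ)) + (B.card : ℝ)
      ≤ (A.card : ℝ)) :
    ∃ S ⊆ A, B ⊆ S ∧ S.card = k ∧ SolFree a₁ a₂ b S := by
  obtain ⟨T, hTA, hT, hcard⟩ := hlamprop (A \ B) fun z hz => hA0 z (Finset.mem_sdiff.mp hz).1
  have hTcard : (k - B.card) * (6 * B.card + 1) ≤ T.card := by
    have hsub : ((A \ B).card : ℝ) = A.card - B.card := by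
      rw [Finset.card_sdiff_of_subset hBA, Nat.cast_sub (Finset.card_le_card hBA)]
    have hle : (6 * (B.card : ℝ) + 1) / lam * (k - B.card) ≤ (A \ B).card := by
      rw [hsub]
      linarith
    have hmul := (mul_le_mul_of_nonneg_left hle hlam.le).trans hcard
    have heq : lam * ((6 * (B.card : ℝ) + 1) / lam * (k - B.card)) =
        (k - B.card) * (6 * B.card + 1) := by
      field_simp
    rw [heq, ← Nat.cast_sub hk] at hmul
    exact_mod_cast hmul
  obtain ⟨I, hIT, hIcard, hI⟩ := exists_card_eq_pairwise_not
    (fun u v => OrderedConflict a₁ a₂ b B u v ∨ OrderedConflict a₁ a₂ b B v u)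
    (fun _ _ => Or.symm) (conflictCandidates a₁ a₂ b B)
    (fun _ _ => mem_conflictCandidates h₁ h₂ hb) _ (card_conflictCandidates_le a₁ a₂ b B)
    (k - B.card) T hTcard
  have hIA : I ⊆ A \ B := hIT.trans hTA
  refine ⟨B ∪ I, Finset.union_subset hBA (hIA.trans Finset.sdiff_subset),
    Finset.subset_union_left, ?_, ?_⟩
  · rw [Finset.card_union_of_disjoint, hIcard, Nat.add_sub_cancel' hk]
    exact Finset.disjoint_of_subset_right hIA Finset.disjoint_sdiff
  · refine hBfree.union ?_ (fun u hu => hext u (hIA hu))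
      fun u hu v hv huv h => hI u hu v hv huv (Or.inl h)
    rintro ⟨x, hx, y, hy, z, hz, h⟩
    exact hT ⟨x, hIT hx, y, hIT hy, z, hIT hz, h⟩
end
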